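/- arXiv:2305.10007 — 2 statements merged into one kernel-verified Lean document; each statement's English description precedes it below -/
import Mathlib

section
/- Let n ≥ 3, let K ⊂ ℝⁿ be compact, and let v be a bounded harmonic function on ℝⁿ ∖ K. Then v has a limit at infinity: there exists c ∈ ℝ such that v(x) → c as |x| → ∞. -/
open Filter

/-- The Laplacian `Δf = ∑ i, ∂²f/∂xᵢ²` of a map `f : ℝⁿ → E`, computed via iterated
Fréchet derivatives in the coordinate directions. -/
noncomputable def vecLaplacian {n : ℕ} {E : Type*} [NormedAddCommGroup E] [NormedSpace ℝ E]
    (f : EuclideanSpace ℝ (Fin n) → E) (x : EuclideanSpace ℝ (Fin n)) : E :=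
  ∑ i : Fin n,
    fderiv ℝ (fun y => fderiv ℝ f y (EuclideanSpace.single i 1)) x (EuclideanSpace.single i 1)

/-- `f` is harmonic on the open set `U`: it is smooth on `U` and `Δf = 0` on `U`. -/
def IsHarmonicOn {n : ℕ} {E : Type*} [NormedAddCommGroup E] [NormedSpace ℝ E]
    (f : EuclideanSpace ℝ (Fin n) → E) (U : Set (EuclideanSpace ℝ (Fin n))) : Prop :=
  ContDiffOn ℝ (⊤ : ℕ∞) f U ∧ ∀ x ∈ U, vecLaplacian f x = 0

open MeasureTheory Metric

/-- There is a bump `Φ` supported in the closed unit ball with gradient `-φ(y) y`, where `φ` is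
continuous, supported in the closed unit ball and of positive integral. -/
theorem exists_radial_bump (n : ℕ) : ∃ Φ φ : EuclideanSpace ℝ (Fin n) → ℝ,
    Continuous φ ∧ (∀ y, 1 < ‖y‖ → φ y = 0) ∧ (∀ y, 1 < ‖y‖ → Φ y = 0) ∧ 0 < ∫ y, φ y ∧
    ∀ y, HasFDerivAt Φ (-(φ y) • innerSL ℝ y) y := by
  have hE : ∀ x : ℝ, HasDerivAt expNegInvGlue (x⁻¹ ^ 2 * expNegInvGlue x) x := fun x => by
    simpa using expNegInvGlue.hasDerivAt_polynomial_eval_inv_mul 1 x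
  have hc : Continuous fun x : ℝ => x⁻¹ ^ 2 * expNegInvGlue x :=
    (expNegInvGlue.continuous_polynomial_eval_inv_mul (Polynomial.X ^ 2)).congr fun x => by
      rw [Polynomial.eval_pow, Polynomial.eval_X]
  have hzero : ∀ y : EuclideanSpace ℝ (Fin n), 1 < ‖y‖ → expNegInvGlue (1 - ‖y‖ ^ 2) = 0 :=
    fun y hy => expNegInvGlue.zero_of_nonpos (by nlinarith)
  let φ : EuclideanSpace ℝ (Fin n) → ℝ :=
    fun y => 2 * ((1 - ‖y‖ ^ 2)⁻¹ ^ 2 * expNegInvGlue (1 - ‖y‖ ^ 2))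
  have hφc : Continuous φ :=
    continuous_const.mul (hc.comp (by fun_prop : Continuous fun y => 1 - ‖y‖ ^ 2))
  have hφ0 : ∀ y, 1 < ‖y‖ → φ y = 0 := fun y hy => by simp [φ, hzero y hy]
  refine ⟨fun y => expNegInvGlue (1 - ‖y‖ ^ 2), φ, hφc, hφ0, hzero, ?_, fun y => ?_⟩
  · refine hφc.integral_pos_of_hasCompactSupport_nonneg_nonzero (x := 0) ?_ (fun y => ?_) ?_
    · exact HasCompactSupport.intro (isCompact_closedBall 0 1)
        fun y hy => hφ0 y (by simpa using hy)
    · have := expNegInvGlue.nonneg (1 - ‖y‖ ^ 2)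
      simp only [φ, Pi.zero_apply]
      positivity
    · simp [φ]
  · have h1 : HasFDerivAt (fun y : EuclideanSpace ℝ (Fin n) => 1 - ‖y‖ ^ 2)
        (-(2 • innerSL ℝ y)) y := (hasStrictFDerivAt_norm_sq y).hasFDerivAt.const_sub 1
    refine ((hE _).comp_hasFDerivAt y h1).congr_fderiv ?_
    ext z
    simp [φ]
    ring

theorem hasCompactSupport_of_eq_zero_of_one_lt_norm {E : Type*} [NormedAddCommGroup E]
    [ProperSpace E] {f : E → ℝ} (h0 : ∀ y, 1 < ‖y‖ → f y = 0) : HasCompactSupport f :=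
  HasCompactSupport.intro (isCompact_closedBall 0 1) fun y hy => h0 y (by simpa using hy)

/-- Differentiation of a weighted average over dilates. -/
theorem hasDerivAt_integral_dilate_mul {n : ℕ} {u φ : EuclideanSpace ℝ (Fin n) → ℝ}
    (hu : ContDiff ℝ 1 u) (hφ : Continuous φ) (hφ0 : ∀ y, 1 < ‖y‖ → φ y = 0)
    (x : EuclideanSpace ℝ (Fin n)) (t : ℝ) :
    HasDerivAt (fun s : ℝ => ∫ y, u (x + s • y) * φ y)
      (∫ y, fderiv ℝ u (x + t • y) y * φ y) t := by
  have hdu : Continuous (fderiv ℝ u) := hu.continuous_fderiv one_ne_zero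
  have hcont : Continuous fun p : ℝ × EuclideanSpace ℝ (Fin n) =>
      fderiv ℝ u (x + p.1 • p.2) p.2 * φ p.2 := by fun_prop
  obtain ⟨C, hC⟩ := ((isCompact_closedBall t 1).prod
    (isCompact_closedBall (0 : EuclideanSpace ℝ (Fin n)) 1)).exists_bound_of_continuousOn
    hcont.continuousOn
  refine (hasDerivAt_integral_of_dominated_loc_of_deriv_le
    (F := fun (s : ℝ) y => u (x + s • y) * φ y)
    (F' := fun (s : ℝ) y => fderiv ℝ u (x + s • y) y * φ y)
    (bound := (closedBall (0 : EuclideanSpace ℝ (Fin n)) 1).indicator fun _ => C)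
    (closedBall_mem_nhds t one_pos) (.of_forall fun s => ?_) ?_ ?_
    (.of_forall fun y s hs => ?_) ?_ (.of_forall fun y s _ => ?_)).2
  · have := hu.continuous
    exact Continuous.aestronglyMeasurable (by fun_prop)
  · have := hu.continuous
    refine Continuous.integrable_of_hasCompactSupport (by fun_prop)
      (hasCompactSupport_of_eq_zero_of_one_lt_norm fun y hy => ?_)
    simp [hφ0 y hy]
  · exact Continuous.aestronglyMeasurable (by fun_prop)
  · by_cases hy : y ∈ closedBall (0 : EuclideanSpace ℝ (Fin n)) 1
    · rw [Set.indicator_of_mem hy]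
      exact hC (s, y) ⟨hs, hy⟩
    · rw [Set.indicator_of_notMem hy, hφ0 y (by simpa using hy)]
      simp
  · exact (integrable_indicator_iff measurableSet_closedBall).2
      (integrableOn_const (isCompact_closedBall _ _).measure_lt_top.ne)
  · have h1 : HasDerivAt (fun s : ℝ => x + s • y) y s := by
      simpa using ((hasDerivAt_id s).smul_const y).const_add x
    exact (((hu.differentiable one_ne_zero _).hasFDerivAt.comp_hasDerivAt s h1).mul_const (φ y))

/-- Integration by parts: the derivative of a radially weighted average of `u` over dilates is a
weighted average of its Laplacian. -/
theorem integral_fderiv_radial_eq {n : ℕ} {u Φ φ : EuclideanSpace ℝ (Fin n) → ℝ}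
    (hu : ContDiff ℝ 2 u) (hφ : Continuous φ) (hφ0 : ∀ y, 1 < ‖y‖ → φ y = 0)
    (hΦ0 : ∀ y, 1 < ‖y‖ → Φ y = 0) (hΦ : ∀ y, HasFDerivAt Φ (-(φ y) • innerSL ℝ y) y)
    (x : EuclideanSpace ℝ (Fin n)) (t : ℝ) :
    ∫ y, fderiv ℝ u (x + t • y) y * φ y = t * ∫ y, vecLaplacian u (x + t • y) * Φ y := by
  let e : Fin n → EuclideanSpace ℝ (Fin n) := fun i => EuclideanSpace.single i 1
  let D : Fin n → EuclideanSpace ℝ (Fin n) → ℝ := fun i z => fderiv ℝ u z (e i)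
  have hD : ∀ i, ContDiff ℝ 1 (D i) := fun i =>
    (hu.fderiv_right (by norm_num)).clm_apply contDiff_const
  have hDc : ∀ i, Continuous (D i) := fun i => (hD i).continuous
  have hDD : ∀ i, Continuous (fderiv ℝ (D i)) := fun i => (hD i).continuous_fderiv one_ne_zero
  have hΦc : Continuous Φ := continuous_iff_continuousAt.2 fun y => (hΦ y).continuousAt
  have hΦi : ∀ i y, fderiv ℝ Φ y (e i) = -(y i * φ y) := fun i y => by
    rw [(hΦ y).fderiv]
    simp [e, EuclideanSpace.inner_single_right, mul_comm]
  have hcomp : ∀ i y, HasFDerivAt (fun y => D i (x + t • y))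
      (t • fderiv ℝ (D i) (x + t • y)) y := fun i y => by
    have h1 : HasFDerivAt (fun y : EuclideanSpace ℝ (Fin n) => x + t • y)
        (t • ContinuousLinearMap.id ℝ _) y := ((hasFDerivAt_id y).const_smul t).const_add x
    refine (((hD i).differentiable one_ne_zero _).hasFDerivAt.comp y h1).congr_fderiv ?_
    ext z
    simp
  have hint1 : ∀ i, Integrable fun y => D i (x + t • y) * (y i * φ y) := fun i => by
    have := hDc i
    refine Continuous.integrable_of_hasCompactSupport (by fun_prop)
      (hasCompactSupport_of_eq_zero_of_one_lt_norm fun y hy => ?_)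
    simp [hφ0 y hy]
  have hint2 : ∀ i, Integrable fun y => D i (x + t • y) * Φ y := fun i => by
    have := hDc i
    refine Continuous.integrable_of_hasCompactSupport (by fun_prop)
      (hasCompactSupport_of_eq_zero_of_one_lt_norm fun y hy => ?_)
    simp [hΦ0 y hy]
  have hint3 : ∀ i, Integrable fun y => fderiv ℝ (D i) (x + t • y) (e i) * Φ y := fun i => by
    have := hDD i
    refine Continuous.integrable_of_hasCompactSupport (by fun_prop)
      (hasCompactSupport_of_eq_zero_of_one_lt_norm fun y hy => ?_)
    simp [hΦ0 y hy]
  have hparts : ∀ i, ∫ y, D i (x + t • y) * (y i * φ y) =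
      t * ∫ y, fderiv ℝ (D i) (x + t • y) (e i) * Φ y := fun i => by
    have h := integral_mul_fderiv_eq_neg_fderiv_mul_of_integrable (μ := volume)
      (f := fun y => D i (x + t • y)) (g := Φ) (v := e i) ?_ ?_ (hint2 i)
      (fun y _ => (hcomp i y).differentiableAt) (fun y _ => (hΦ y).differentiableAt)
    · simp only [hΦi, (hcomp i _).fderiv, mul_neg, integral_neg, neg_inj,
        smul_apply, smul_eq_mul, mul_assoc, integral_const_mul] at h
      exact h
    · simpa only [(hcomp i _).fderiv, smul_apply, smul_eq_mul, mul_assoc]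
        using (hint3 i).const_mul t
    · simp only [hΦi, mul_neg]
      exact (hint1 i).neg
  have hsplit : ∀ y, fderiv ℝ u (x + t • y) y * φ y =
      ∑ i, D i (x + t • y) * (y i * φ y) := fun y => by
    have hy : y = ∑ i, y i • e i := by
      ext j
      simp [e, Finset.sum_apply, Pi.single_apply]
    have h : fderiv ℝ u (x + t • y) y = ∑ i, y i * D i (x + t • y) := by
      conv_lhs => rw [hy, map_sum]
      simp only [map_smul, smul_eq_mul, ← hy, D]
    rw [h, Finset.sum_mul]
    exact Finset.sum_congr rfl fun i _ => by ring
  simp only [hsplit]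
  rw [integral_finsetSum _ fun i _ => hint1 i]
  simp only [hparts, vecLaplacian, Finset.sum_mul]
  rw [integral_finsetSum _ fun i _ => hint3 i, Finset.mul_sum]

theorem tendsto_integral_abs_translate_sub {n : ℕ} {φ : EuclideanSpace ℝ (Fin n) → ℝ}
    (hφ : Continuous φ) (hφ0 : ∀ y, 1 < ‖y‖ → φ y = 0) :
    Tendsto (fun h => ∫ y, |φ (y + h) - φ y|) (nhds 0) (nhds 0) := by
  obtain ⟨C, hC⟩ := hφ.bounded_above_of_compact_support
    (hasCompactSupport_of_eq_zero_of_one_lt_norm hφ0)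
  have key : Tendsto (fun h => ∫ y, |φ (y + h) - φ y|) (nhds 0)
      (nhds (∫ y, |φ (y + 0) - φ y|)) := by
    refine tendsto_integral_filter_of_dominated_convergence
      ((closedBall (0 : EuclideanSpace ℝ (Fin n)) 2).indicator fun _ => C + C)
      (.of_forall fun h => Continuous.aestronglyMeasurable (by fun_prop)) ?_ ?_
      (.of_forall fun y => Continuous.tendsto (by fun_prop) 0)
    · filter_upwards [closedBall_mem_nhds (0 : EuclideanSpace ℝ (Fin n)) one_pos] with h hh
      refine .of_forall fun y => ?_
      rw [mem_closedBall_zero_iff] at hh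
      rw [Real.norm_eq_abs, abs_abs]
      by_cases hy : y ∈ closedBall (0 : EuclideanSpace ℝ (Fin n)) 2
      · rw [Set.indicator_of_mem hy]
        exact (abs_sub _ _).trans (add_le_add (hC _) (hC _))
      · rw [Set.indicator_of_notMem hy]
        have hy2 : 2 < ‖y‖ := by simpa using hy
        have hyh : 1 < ‖y + h‖ := by
          have := norm_sub_le (y + h) h
          rw [add_sub_cancel_right] at this
          linarith
        simp [hφ0 y (by linarith), hφ0 _ hyh]
    · exact (integrable_indicator_iff measurableSet_closedBall).2
        (integrableOn_const (isCompact_closedBall _ _).measure_lt_top.ne)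
  simpa using key

/-- For a bounded function, weighted averages over large dilates do not depend asymptotically on
the centre. -/
theorem tendsto_integral_dilate_mul_sub {n : ℕ} {u φ : EuclideanSpace ℝ (Fin n) → ℝ} {M : ℝ}
    (hu : Continuous u) (hM : ∀ x, |u x| ≤ M) (hφ : Continuous φ)
    (hφ0 : ∀ y, 1 < ‖y‖ → φ y = 0) (x x' : EuclideanSpace ℝ (Fin n)) :
    Tendsto (fun t : ℝ => (∫ y, u (x' + t • y) * φ y) - ∫ y, u (x + t • y) * φ y)
      atTop (nhds 0) := by
  have hlim : Tendsto (fun t : ℝ => t⁻¹ • (x - x')) atTop (nhds 0) := by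
    simpa using (tendsto_inv_atTop_zero (𝕜 := ℝ)).smul_const (x - x')
  have hbound := ((tendsto_integral_abs_translate_sub hφ hφ0).comp hlim).const_mul M
  rw [mul_zero] at hbound
  refine squeeze_zero_norm' ?_ hbound
  filter_upwards [eventually_gt_atTop 0] with t ht
  set h := t⁻¹ • (x - x') with hh
  have hcs := hasCompactSupport_of_eq_zero_of_one_lt_norm hφ0
  have hint : ∀ z, Integrable fun y => u (z + t • y) * φ y := fun z =>
    Continuous.integrable_of_hasCompactSupport (by fun_prop)
      (hasCompactSupport_of_eq_zero_of_one_lt_norm fun y hy => by simp [hφ0 y hy])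
  have hpt : ∀ y, u (x' + t • (y + h)) * φ (y + h) = u (x + t • y) * φ (y + h) := fun y => by
    congr 2
    rw [hh, smul_add, smul_inv_smul₀ ht.ne']
    abel
  have hint' : Integrable fun y => u (x + t • y) * φ (y + h) := by
    simpa only [hpt] using (hint x').comp_add_right h
  have hφi : Integrable φ := hφ.integrable_of_hasCompactSupport hcs
  rw [← integral_add_right_eq_self (fun y => u (x' + t • y) * φ y) h]
  simp only [hpt, Function.comp_apply]
  rw [← integral_sub hint' (hint x), ← integral_const_mul]
  refine norm_integral_le_of_norm_le
    (((hφi.comp_add_right h).sub hφi).abs.const_mul M) (.of_forall fun y => ?_)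
  rw [← mul_sub, norm_mul]
  exact mul_le_mul_of_nonneg_right (hM _) (abs_nonneg _)

theorem integral_dilate_mul_eq_zero {n : ℕ} {g Φ : EuclideanSpace ℝ (Fin n) → ℝ} {R : ℝ}
    (hg0 : ∀ z, R < ‖z‖ → g z = 0) (hΦ0 : ∀ y, 1 < ‖y‖ → Φ y = 0)
    {x : EuclideanSpace ℝ (Fin n)} {t : ℝ} (ht : 0 ≤ t) (hx : t + R < ‖x‖) :
    ∫ y, g (x + t • y) * Φ y = 0 := by
  refine integral_eq_zero_of_ae (.of_forall fun y => ?_)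
  rcases lt_or_ge 1 ‖y‖ with hy | hy
  · simp [hΦ0 y hy]
  · have h1 : ‖t • y‖ ≤ t := by
      rw [norm_smul, Real.norm_of_nonneg ht]
      nlinarith
    have h2 := norm_sub_le (x + t • y) (t • y)
    rw [add_sub_cancel_right] at h2
    simp [hg0 (x + t • y) (by linarith)]

theorem abs_mul_integral_dilate_mul_le {n : ℕ} (hn : 3 ≤ n)
    {g Φ : EuclideanSpace ℝ (Fin n) → ℝ} {R G B : ℝ} (hR : 0 ≤ R)
    (hg0 : ∀ z, R < ‖z‖ → g z = 0) (hG : ∀ z, |g z| ≤ G) (hB : ∀ y, |Φ y| ≤ B)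
    (x : EuclideanSpace ℝ (Fin n)) {t : ℝ} (ht : 1 ≤ t) :
    |t * ∫ y, g (x + t • y) * Φ y| ≤
      G * B * R ^ n * volume.real (ball (0 : EuclideanSpace ℝ (Fin n)) 1) * t⁻¹ ^ 2 := by
  have ht0 : 0 < t := by linarith
  have hG0 : 0 ≤ G := (abs_nonneg _).trans (hG 0)
  have hB0 : 0 ≤ B := (abs_nonneg _).trans (hB 0)
  set S := closedBall (-(t⁻¹ • x)) (t⁻¹ * R)
  have hS : ∀ y, y ∉ S → g (x + t • y) * Φ y = 0 := fun y hy => by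
    have h1 : t⁻¹ * R < ‖y + t⁻¹ • x‖ := by
      simpa [S, dist_eq_norm] using hy
    have h2 : x + t • y = t • (y + t⁻¹ • x) := by
      rw [smul_add, smul_inv_smul₀ ht0.ne', add_comm]
    rw [hg0 (x + t • y), zero_mul]
    rw [h2, norm_smul, Real.norm_of_nonneg ht0.le]
    calc R = t * (t⁻¹ * R) := by field_simp
      _ < _ := by gcongr
  rw [← setIntegral_eq_integral_of_forall_compl_eq_zero hS, abs_mul, abs_of_pos ht0]
  have hI : |∫ y in S, g (x + t • y) * Φ y| ≤ G * B * volume.real S := by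
    rw [← Real.norm_eq_abs]
    refine norm_setIntegral_le_of_norm_le_const measure_closedBall_lt_top fun y _ => ?_
    rw [norm_mul]
    exact mul_le_mul (hG _) (hB _) (abs_nonneg _) hG0
  have hvol : volume.real S =
      (t⁻¹ * R) ^ n * volume.real (ball (0 : EuclideanSpace ℝ (Fin n)) 1) := by
    rw [Measure.addHaar_real_closedBall volume _ (by positivity), finrank_euclideanSpace_fin]
  have hpow : t * t⁻¹ ^ n ≤ t⁻¹ ^ 2 := by
    calc t * t⁻¹ ^ n ≤ t * t⁻¹ ^ 3 := by
          gcongr t * ?_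
          exact pow_le_pow_of_le_one (by positivity) (inv_le_one_of_one_le₀ ht) hn
      _ = t⁻¹ ^ 2 := by field_simp
  have hnn : 0 ≤ G * B * R ^ n * volume.real (ball (0 : EuclideanSpace ℝ (Fin n)) 1) := by
    positivity
  calc t * |∫ y in S, g (x + t • y) * Φ y| ≤ t * (G * B * volume.real S) := by gcongr
    _ = G * B * R ^ n * volume.real (ball (0 : EuclideanSpace ℝ (Fin n)) 1) * (t * t⁻¹ ^ n) := by
      rw [hvol, mul_pow]
      ring
    _ ≤ _ := by gcongr

theorem abs_sub_le_div_of_deriv_le_inv_sq {m m' : ℝ → ℝ} {A a T : ℝ} (ha : 0 < a)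
    (hm : ∀ t, HasDerivAt m (m' t) t) (h0 : ∀ t, 0 ≤ t → t ≤ a → m' t = 0) (hA : 0 ≤ A)
    (hb : ∀ t, a ≤ t → |m' t| ≤ A * t⁻¹ ^ 2) (hT : a ≤ T) : |m T - m 0| ≤ A / a := by
  have hconst : m a = m 0 :=
    constant_of_has_deriv_right_zero (fun t _ => (hm t).continuousAt.continuousWithinAt)
      (fun t ht => (h0 t ht.1 ht.2.le) ▸ (hm t).hasDerivWithinAt) a ⟨ha.le, le_rfl⟩
  have hBd : ∀ t, a ≤ t → HasDerivAt (fun t => A * (a⁻¹ - t⁻¹)) (A * t⁻¹ ^ 2) t := fun t ht => by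
    have := ((hasDerivAt_inv (ha.trans_le ht).ne').const_sub a⁻¹).const_mul A
    simpa using this
  have h := image_norm_le_of_norm_deriv_right_le_deriv_boundary' (a := a) (b := T)
    (f := fun t => m t - m 0) (f' := m') (B := fun t => A * (a⁻¹ - t⁻¹))
    (B' := fun t => A * t⁻¹ ^ 2)
    (fun t _ => ((hm t).sub_const _).continuousAt.continuousWithinAt)
    (fun t _ => ((hm t).sub_const _).hasDerivWithinAt) (by simp [hconst])
    (fun t ht => (hBd t ht.1).continuousAt.continuousWithinAt)
    (fun t ht => (hBd t ht.1).hasDerivWithinAt) (fun t ht => hb t ht.1) ⟨hT, le_rfl⟩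
  refine h.trans ?_
  have : 0 ≤ T⁻¹ := inv_nonneg.2 (ha.le.trans hT)
  rw [div_eq_mul_inv]
  gcongr
  linarith

theorem continuous_vecLaplacian {n : ℕ} {u : EuclideanSpace ℝ (Fin n) → ℝ}
    (hu : ContDiff ℝ 2 u) : Continuous (vecLaplacian u) := by
  refine continuous_finsetSum _ fun i _ => ?_
  have hD : ContDiff ℝ 1 fun y => fderiv ℝ u y (EuclideanSpace.single i 1) :=
    (hu.fderiv_right (by norm_num)).clm_apply contDiff_const
  exact (hD.continuous_fderiv one_ne_zero).clm_apply continuous_const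

/-- A bounded `C²` function on `ℝⁿ`, `n ≥ 3`, whose Laplacian has bounded support converges at
infinity. -/
theorem exists_tendsto_of_vecLaplacian_eq_zero {n : ℕ} (hn : 3 ≤ n)
    {u : EuclideanSpace ℝ (Fin n) → ℝ} (hu : ContDiff ℝ 2 u) {M R : ℝ} (hM : ∀ x, |u x| ≤ M)
    (hR : 0 ≤ R) (hlap : ∀ z, R < ‖z‖ → vecLaplacian u z = 0) :
    ∃ c : ℝ, Tendsto u (comap norm atTop) (nhds c) := by
  obtain ⟨Φ, φ, hφ, hφ0, hΦ0, hpos, hΦ⟩ := exists_radial_bump n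
  have hΦc : Continuous Φ := continuous_iff_continuousAt.2 fun y => (hΦ y).continuousAt
  obtain ⟨B, hB⟩ := hΦc.bounded_above_of_compact_support
    (hasCompactSupport_of_eq_zero_of_one_lt_norm hΦ0)
  obtain ⟨G, hG⟩ := (continuous_vecLaplacian hu).bounded_above_of_compact_support
    (HasCompactSupport.intro (isCompact_closedBall 0 R) fun z hz => hlap z (by simpa using hz))
  set A := G * B * R ^ n * volume.real (ball (0 : EuclideanSpace ℝ (Fin n)) 1)
  set I := ∫ y, φ y
  have hG0 : 0 ≤ G := (norm_nonneg _).trans (hG 0)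
  have hB0 : 0 ≤ B := (norm_nonneg _).trans (hB 0)
  have hA : 0 ≤ A := by positivity
  have hmean : ∀ x a T, 1 ≤ a → a + R < ‖x‖ → a ≤ T →
      |(∫ y, u (x + T • y) * φ y) - u x * I| ≤ A / a := fun x a T ha hx hT => by
    have hder : ∀ t, HasDerivAt (fun s : ℝ => ∫ y, u (x + s • y) * φ y)
        (t * ∫ y, vecLaplacian u (x + t • y) * Φ y) t := fun t => by
      rw [← integral_fderiv_radial_eq hu hφ hφ0 hΦ0 hΦ]
      exact hasDerivAt_integral_dilate_mul (hu.of_le one_le_two) hφ hφ0 x t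
    have h := abs_sub_le_div_of_deriv_le_inv_sq (by linarith) hder
      (fun t ht hta => by
        rw [integral_dilate_mul_eq_zero hlap hΦ0 ht (by linarith), mul_zero])
      hA (fun t ht => abs_mul_integral_dilate_mul_le hn hR hlap hG hB x (ha.trans ht)) hT
    simpa [integral_const_mul] using h
  have hosc : ∀ a x x', 1 ≤ a → a + R < ‖x‖ → a + R < ‖x'‖ →
      |u x - u x'| * I ≤ 2 * (A / a) := fun a x x' ha hx hx' => by
    refine ge_of_tendsto (x := atTop) (f := fun t : ℝ =>
      2 * (A / a) + |(∫ y, u (x' + t • y) * φ y) - ∫ y, u (x + t • y) * φ y|) ?_ ?_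
    · simpa using (tendsto_integral_dilate_mul_sub hu.continuous hM hφ hφ0 x x').abs.const_add
        (2 * (A / a))
    · filter_upwards [eventually_ge_atTop a] with T hT
      have h1 := abs_le.1 (hmean x a T ha hx hT)
      have h2 := abs_le.1 (hmean x' a T ha hx' hT)
      rw [← abs_of_pos hpos, ← abs_mul, sub_mul]
      set p := ∫ y, u (x + T • y) * φ y
      set q := ∫ y, u (x' + T • y) * φ y
      have h3 := neg_abs_le (q - p)
      have h4 := le_abs_self (q - p)
      exact abs_le.2 ⟨by linarith, by linarith⟩
  rcases (comap (norm : EuclideanSpace ℝ (Fin n) → ℝ) atTop).eq_or_neBot with hbot | _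
  · exact ⟨0, hbot ▸ tendsto_bot⟩
  refine cauchy_map_iff_exists_tendsto.1 (Metric.cauchy_iff.2 ⟨inferInstance, fun ε hε => ?_⟩)
  obtain ⟨a, ha1, ha⟩ : ∃ a : ℝ, 1 ≤ a ∧ 2 * (A / a) < ε * I := by
    have h : Tendsto (fun a : ℝ => 2 * (A / a)) atTop (nhds 0) := by
      simpa using (tendsto_const_nhds.div_atTop tendsto_id : Tendsto (fun a : ℝ => A / a)
        atTop (nhds 0)).const_mul 2
    exact ((eventually_ge_atTop 1).and (h.eventually_lt_const (mul_pos hε hpos))).exists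
  refine ⟨u '' {x | a + R < ‖x‖}, image_mem_map (preimage_mem_comap (Ioi_mem_atTop (a + R))), ?_⟩
  rintro _ ⟨x, hx, rfl⟩ _ ⟨x', hx', rfl⟩
  exact lt_of_mul_lt_mul_right ((hosc a x x' ha1 hx hx').trans_lt ha) hpos.le

/-- Away from a ball containing the compact set `K`, a function smooth and bounded off `K` agrees
with a smooth bounded function on the whole space. -/
theorem exists_contDiff_bounded_eq_of_isCompact {n : ℕ} {K : Set (EuclideanSpace ℝ (Fin n))}
    (hK : IsCompact K) {v : EuclideanSpace ℝ (Fin n) → ℝ} (hv : ContDiffOn ℝ 2 v Kᶜ) {M : ℝ}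
    (hM : ∀ x ∈ Kᶜ, |v x| ≤ M) :
    ∃ (u : EuclideanSpace ℝ (Fin n) → ℝ) (R M' : ℝ), ContDiff ℝ 2 u ∧ (∀ x, |u x| ≤ M') ∧ 0 ≤ R ∧
      ∀ x, R < ‖x‖ → x ∈ Kᶜ ∧ u x = v x := by
  obtain ⟨r, hr, hKr⟩ := hK.isBounded.subset_ball_lt 0 0
  let b : ContDiffBump (0 : EuclideanSpace ℝ (Fin n)) := ⟨r, r + 1, hr, by linarith⟩
  have hb1 : ∀ x ∈ ball (0 : EuclideanSpace ℝ (Fin n)) r, (1 - b x) * v x = 0 := fun x hx => by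
    rw [b.one_of_mem_closedBall (ball_subset_closedBall hx), sub_self, zero_mul]
  refine ⟨fun x => (1 - b x) * v x, r + 1, max M 0, ?_, fun x => ?_, by linarith, fun x hx => ?_⟩
  · refine contDiff_iff_contDiffAt.2 fun x => ?_
    by_cases hx : x ∈ K
    · exact (contDiffAt_const (c := (0 : ℝ))).congr_of_eventuallyEq
        (mem_of_superset (isOpen_ball.mem_nhds (hKr hx)) hb1)
    · exact (contDiffAt_const.sub b.contDiffAt).mul
        (hv.contDiffAt (hK.isClosed.isOpen_compl.mem_nhds hx))
  · by_cases hx : x ∈ K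
    · simp [hb1 x (hKr hx)]
    · rw [abs_mul, abs_of_nonneg (sub_nonneg.2 b.le_one)]
      have h1 := hM x hx
      have h2 : 0 ≤ b x := b.nonneg
      refine le_trans ?_ (h1.trans (le_max_left _ _))
      exact mul_le_of_le_one_left (abs_nonneg _) (by linarith)
  · have hxK : x ∉ K := fun h => by
      have := mem_ball_zero_iff.1 (hKr h)
      linarith
    have hb0 : b x = 0 := b.zero_of_le_dist (by simpa [b] using hx.le)
    exact ⟨hxK, by simp [hb0]⟩

theorem vecLaplacian_congr_of_eventuallyEq {n : ℕ} {u v : EuclideanSpace ℝ (Fin n) → ℝ}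
    {x : EuclideanSpace ℝ (Fin n)} (h : u =ᶠ[nhds x] v) :
    vecLaplacian u x = vecLaplacian v x := by
  refine Finset.sum_congr rfl fun i _ => ?_
  have h' : (fun y => fderiv ℝ u y (EuclideanSpace.single i 1)) =ᶠ[nhds x]
      fun y => fderiv ℝ v y (EuclideanSpace.single i 1) :=
    (h.fderiv (𝕜 := ℝ)).mono fun y hy => congrArg (· (EuclideanSpace.single i 1)) hy
  rw [h'.fderiv_eq]

/-- Let `n ≥ 3`, `K ⊂ ℝⁿ` compact, and let `v` be a bounded harmonic function on `ℝⁿ ∖ K`.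
Then `v` has a limit at infinity: there is `c ∈ ℝ` with `v x → c` as `|x| → ∞`. -/
theorem bounded_harmonic_has_limit_at_infinity (n : ℕ) (hn : 3 ≤ n)
    (K : Set (EuclideanSpace ℝ (Fin n))) (hK : IsCompact K)
    (v : EuclideanSpace ℝ (Fin n) → ℝ)
    (hv : IsHarmonicOn v Kᶜ)
    (hbd : ∃ M, ∀ x ∈ Kᶜ, |v x| ≤ M) :
    ∃ c : ℝ, Tendsto v (comap norm atTop) (nhds c) := by
  obtain ⟨M, hM⟩ := hbd
  obtain ⟨u, R, M', hu, hM', hR, huv⟩ :=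
    exists_contDiff_bounded_eq_of_isCompact hK (hv.1.of_le (WithTop.coe_le_coe.2 le_top)) hM
  obtain ⟨c, hc⟩ := exists_tendsto_of_vecLaplacian_eq_zero hn hu hM' hR fun z hz => by
    rw [← hv.2 z (huv z hz).1]
    refine vecLaplacian_congr_of_eventuallyEq ?_
    filter_upwards [(isOpen_lt continuous_const continuous_norm).mem_nhds hz] with y hy
    exact (huv y hy).2
  refine ⟨c, hc.congr' ?_⟩
  filter_upwards [preimage_mem_comap (Ioi_mem_atTop R)] with y hy
  exact (huv y hy).2
end

section
/- Let n ≥ 3, δ ∈ ℝ, R > 0, and let f be a harmonic function on {x ∈ ℝⁿ : |x| > R} with f = 𝒪_∞(r^δ). Then f = 𝒪_∞(r^{k₋(δ)}), where k₋(δ) denotes the largest element of the exceptional set 𝔈 = ℕ ∪ {k ∈ ℤ : k ≤ 2 − n} that is ≤ δ. -/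
/-- `f = 𝒪_∞(r^α)` on `{|x| > R}`: for every `j ∈ ℕ` there are `C > 0` and `R₀ ≥ R` such
that the `j`-th total derivative satisfies `‖D^j f(x)‖ ≤ C |x|^{α−j}` for all `|x| ≥ R₀`. -/
def BigOInfty {n : ℕ} {E : Type*} [NormedAddCommGroup E] [NormedSpace ℝ E]
    (f : EuclideanSpace ℝ (Fin n) → E) (R α : ℝ) : Prop :=
  ∀ j : ℕ, ∃ C > 0, ∃ R₀ ≥ R, ∀ x : EuclideanSpace ℝ (Fin n), R₀ ≤ ‖x‖ →
    ‖iteratedFDeriv ℝ j f x‖ ≤ C * ‖x‖ ^ (α - (j : ℝ))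

open Filter Asymptotics Topology Bornology
open scoped ContDiff

section ExteriorCalculus

variable {n : ℕ} {R : ℝ} {f g : EuclideanSpace ℝ (Fin n) → ℝ} {x : EuclideanSpace ℝ (Fin n)}

/-- The `i`-th partial derivative. -/
noncomputable def partialDeriv (i : Fin n) (f : EuclideanSpace ℝ (Fin n) → ℝ)
    (x : EuclideanSpace ℝ (Fin n)) : ℝ :=
  fderiv ℝ f x (EuclideanSpace.single i 1)

/-- `f` is smooth at every point of `{|x| > R}`. -/
def SmoothOutside (R : ℝ) (f : EuclideanSpace ℝ (Fin n) → ℝ) : Prop :=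
  ∀ x, R < ‖x‖ → ContDiffAt ℝ ∞ f x

lemma isOpen_exterior (R : ℝ) : IsOpen {x : EuclideanSpace ℝ (Fin n) | R < ‖x‖} :=
  isOpen_lt continuous_const continuous_norm

lemma eventually_nhds_exterior (hx : R < ‖x‖) : ∀ᶠ y in 𝓝 x, R < ‖y‖ :=
  (isOpen_exterior R).mem_nhds hx

lemma vecLaplacian_eq_sum (f : EuclideanSpace ℝ (Fin n) → ℝ) (x : EuclideanSpace ℝ (Fin n)) :
    vecLaplacian f x = ∑ i, partialDeriv i (partialDeriv i f) x := rfl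

lemma SmoothOutside.differentiableAt (hf : SmoothOutside R f) (hx : R < ‖x‖) :
    DifferentiableAt ℝ f x :=
  (hf x hx).differentiableAt (by simp)

lemma SmoothOutside.continuousAt (hf : SmoothOutside R f) (hx : R < ‖x‖) : ContinuousAt f x :=
  (hf x hx).continuousAt

lemma SmoothOutside.add (hf : SmoothOutside R f) (hg : SmoothOutside R g) :
    SmoothOutside R (fun x => f x + g x) :=
  fun x hx => (hf x hx).add (hg x hx)

lemma SmoothOutside.sub (hf : SmoothOutside R f) (hg : SmoothOutside R g) :
    SmoothOutside R (fun x => f x - g x) :=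
  fun x hx => (hf x hx).sub (hg x hx)

lemma SmoothOutside.const_mul (c : ℝ) (hf : SmoothOutside R f) :
    SmoothOutside R (fun x => c * f x) :=
  fun x hx => contDiffAt_const.mul (hf x hx)

lemma contDiff_coord (l : Fin n) : ContDiff ℝ ∞ (fun x : EuclideanSpace ℝ (Fin n) => x l) :=
  (EuclideanSpace.proj (𝕜 := ℝ) l).contDiff

lemma SmoothOutside.coord_mul (l : Fin n) (hf : SmoothOutside R f) :
    SmoothOutside R (fun x => x l * f x) :=
  fun x hx => (contDiff_coord l).contDiffAt.mul (hf x hx)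

lemma SmoothOutside.sum {u : Fin n → EuclideanSpace ℝ (Fin n) → ℝ}
    (hu : ∀ l, SmoothOutside R (u l)) : SmoothOutside R (fun x => ∑ l, u l x) :=
  fun x hx => ContDiffAt.sum fun l _ => hu l x hx

lemma SmoothOutside.partialDeriv (hf : SmoothOutside R f) (i : Fin n) :
    SmoothOutside R (partialDeriv i f) :=
  fun x hx => ((hf x hx).fderiv_right (m := ∞) (by simp)).clm_apply contDiffAt_const

lemma partialDeriv_congr (h : ∀ x, R < ‖x‖ → f x = g x) (hx : R < ‖x‖) (i : Fin n) :
    partialDeriv i f x = partialDeriv i g x := by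
  have : f =ᶠ[𝓝 x] g := (eventually_nhds_exterior hx).mono h
  simp [partialDeriv, this.fderiv_eq]

lemma partialDeriv_add (hf : DifferentiableAt ℝ f x) (hg : DifferentiableAt ℝ g x) (i : Fin n) :
    partialDeriv i (fun x => f x + g x) x = partialDeriv i f x + partialDeriv i g x := by
  simp [partialDeriv, fderiv_fun_add hf hg]

lemma partialDeriv_sub (hf : DifferentiableAt ℝ f x) (hg : DifferentiableAt ℝ g x) (i : Fin n) :
    partialDeriv i (fun x => f x - g x) x = partialDeriv i f x - partialDeriv i g x := by
  simp [partialDeriv, fderiv_fun_sub hf hg]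

lemma partialDeriv_const_mul (c : ℝ) (hf : DifferentiableAt ℝ f x) (i : Fin n) :
    partialDeriv i (fun x => c * f x) x = c * partialDeriv i f x := by
  simp [partialDeriv, fderiv_const_mul hf]

lemma partialDeriv_sum {u : Fin n → EuclideanSpace ℝ (Fin n) → ℝ}
    (hu : ∀ l, DifferentiableAt ℝ (u l) x) (i : Fin n) :
    partialDeriv i (fun x => ∑ l, u l x) x = ∑ l, partialDeriv i (u l) x := by
  simp [partialDeriv, fderiv_fun_sum fun l _ => hu l]

lemma hasFDerivAt_coord (l : Fin n) (x : EuclideanSpace ℝ (Fin n)) :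
    HasFDerivAt (fun x : EuclideanSpace ℝ (Fin n) => x l) (EuclideanSpace.proj (𝕜 := ℝ) l) x :=
  (EuclideanSpace.proj (𝕜 := ℝ) l).hasFDerivAt

lemma partialDeriv_coord_mul (l : Fin n) (hf : DifferentiableAt ℝ f x) (i : Fin n) :
    partialDeriv i (fun x => x l * f x) x
      = (if l = i then 1 else 0) * f x + x l * partialDeriv i f x := by
  have := (hasFDerivAt_coord l x).mul hf.hasFDerivAt
  change fderiv ℝ ((fun x : EuclideanSpace ℝ (Fin n) => x l) * f) x _ = _
  rw [this.fderiv]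
  simp [partialDeriv]
  ring_nf

lemma partialDeriv_comm (hf : SmoothOutside R f) (hx : R < ‖x‖) (i j : Fin n) :
    partialDeriv i (partialDeriv j f) x = partialDeriv j (partialDeriv i f) x := by
  have hd : DifferentiableAt ℝ (fderiv ℝ f) x :=
    ((hf x hx).fderiv_right (m := ∞) (by simp)).differentiableAt (by simp)
  have hs : IsSymmSndFDerivAt ℝ f x := (hf x hx).isSymmSndFDerivAt
    (by simpa using WithTop.coe_le_coe.2 (le_top : (2 : ℕ∞) ≤ ⊤))
  have key : ∀ v w, fderiv ℝ (fun y => fderiv ℝ f y v) x w = fderiv ℝ (fderiv ℝ f) x w v := by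
    intro v w
    rw [fderiv_clm_apply hd (by fun_prop)]
    simp
  simp only [partialDeriv]
  erw [key, key]
  exact hs _ _

lemma vecLaplacian_add (hf : SmoothOutside R f) (hg : SmoothOutside R g) (hx : R < ‖x‖) :
    vecLaplacian (fun x => f x + g x) x = vecLaplacian f x + vecLaplacian g x := by
  simp only [vecLaplacian_eq_sum, ← Finset.sum_add_distrib]
  refine Finset.sum_congr rfl fun i _ => ?_
  rw [← partialDeriv_add ((hf.partialDeriv i).differentiableAt hx)
    ((hg.partialDeriv i).differentiableAt hx)]
  exact partialDeriv_congr (fun y hy =>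
    partialDeriv_add (hf.differentiableAt hy) (hg.differentiableAt hy) i) hx i

lemma vecLaplacian_const_mul (c : ℝ) (hf : SmoothOutside R f) (hx : R < ‖x‖) :
    vecLaplacian (fun x => c * f x) x = c * vecLaplacian f x := by
  simp only [vecLaplacian_eq_sum, Finset.mul_sum]
  refine Finset.sum_congr rfl fun i _ => ?_
  rw [← partialDeriv_const_mul c ((hf.partialDeriv i).differentiableAt hx)]
  exact partialDeriv_congr (fun y hy =>
    partialDeriv_const_mul c (hf.differentiableAt hy) i) hx i

lemma vecLaplacian_sub (hf : SmoothOutside R f) (hg : SmoothOutside R g) (hx : R < ‖x‖) :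
    vecLaplacian (fun x => f x - g x) x = vecLaplacian f x - vecLaplacian g x := by
  have := vecLaplacian_add hf (hg.const_mul (-1)) hx
  rw [vecLaplacian_const_mul _ hg hx] at this
  simpa [sub_eq_add_neg] using this

lemma vecLaplacian_sum {u : Fin n → EuclideanSpace ℝ (Fin n) → ℝ}
    (hu : ∀ l, SmoothOutside R (u l)) (hx : R < ‖x‖) :
    vecLaplacian (fun x => ∑ l, u l x) x = ∑ l, vecLaplacian (u l) x := by
  simp only [vecLaplacian_eq_sum]
  rw [Finset.sum_comm]
  refine Finset.sum_congr rfl fun i _ => ?_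
  rw [← partialDeriv_sum fun l => ((hu l).partialDeriv i).differentiableAt hx]
  exact partialDeriv_congr (fun y hy =>
    partialDeriv_sum (fun l => (hu l).differentiableAt hy) i) hx i

lemma vecLaplacian_coord_mul (l : Fin n) (hf : SmoothOutside R f) (hx : R < ‖x‖) :
    vecLaplacian (fun x => x l * f x) x = x l * vecLaplacian f x + 2 * partialDeriv l f x := by
  have key : ∀ i, partialDeriv i (partialDeriv i fun x => x l * f x) x
      = x l * partialDeriv i (partialDeriv i f) x
        + if l = i then 2 * partialDeriv i f x else 0 := by
    intro i
    rw [partialDeriv_congr (fun y hy => partialDeriv_coord_mul l (hf.differentiableAt hy) i) hx i,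
      partialDeriv_add ((hf.const_mul _).differentiableAt hx)
        (((hf.partialDeriv i).coord_mul l).differentiableAt hx),
      partialDeriv_const_mul _ (hf.differentiableAt hx),
      partialDeriv_coord_mul l ((hf.partialDeriv i).differentiableAt hx)]
    split_ifs <;> ring
  simp only [vecLaplacian_eq_sum, key, Finset.sum_add_distrib, ← Finset.mul_sum]
  simp

lemma vecLaplacian_partialDeriv (hf : SmoothOutside R f) (hx : R < ‖x‖) (j : Fin n) :
    vecLaplacian (partialDeriv j f) x = partialDeriv j (vecLaplacian f) x := by
  have : vecLaplacian f = fun x => ∑ i, partialDeriv i (partialDeriv i f) x := rfl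
  rw [this, partialDeriv_sum fun i => ((hf.partialDeriv i).partialDeriv i).differentiableAt hx,
    vecLaplacian_eq_sum]
  refine Finset.sum_congr rfl fun i _ => ?_
  rw [partialDeriv_congr (fun y hy => partialDeriv_comm hf hy i j) hx i,
    partialDeriv_comm (hf.partialDeriv i) hx]

/-- `f` is smooth with vanishing Laplacian at every point of `{|x| > R}`. -/
def HarmonicOutside (R : ℝ) (f : EuclideanSpace ℝ (Fin n) → ℝ) : Prop :=
  SmoothOutside R f ∧ ∀ x, R < ‖x‖ → vecLaplacian f x = 0

/-- The Euler field `∑ xₗ ∂ₗ`. -/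
noncomputable def eulerField (f : EuclideanSpace ℝ (Fin n) → ℝ) (x : EuclideanSpace ℝ (Fin n)) :
    ℝ :=
  ∑ l, x l * partialDeriv l f x

/-- The rotation field `xₗ ∂ᵢ - xᵢ ∂ₗ`. -/
noncomputable def rotationField (l i : Fin n) (f : EuclideanSpace ℝ (Fin n) → ℝ)
    (x : EuclideanSpace ℝ (Fin n)) : ℝ :=
  x l * partialDeriv i f x - x i * partialDeriv l f x

/-- The first order operator `|x|² ∂ᵢ - 2 xᵢ ∑ xₗ ∂ₗ - (n - 2) xᵢ`, the conjugate of `∂ᵢ`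
under the Kelvin transform. -/
noncomputable def kelvinField (i : Fin n) (f : EuclideanSpace ℝ (Fin n) → ℝ)
    (x : EuclideanSpace ℝ (Fin n)) : ℝ :=
  (∑ l, x l * rotationField l i f x) - x i * (eulerField f x + ((n : ℝ) - 2) * f x)

lemma HarmonicOutside.partialDeriv (hf : HarmonicOutside R f) (j : Fin n) :
    HarmonicOutside R (partialDeriv j f) := by
  refine ⟨hf.1.partialDeriv j, fun x hx => ?_⟩
  rw [vecLaplacian_partialDeriv hf.1 hx, partialDeriv_congr (g := fun _ => 0) hf.2 hx]
  simp [_root_.partialDeriv]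

lemma HarmonicOutside.sub (hf : HarmonicOutside R f) (hg : HarmonicOutside R g) :
    HarmonicOutside R (fun x => f x - g x) :=
  ⟨hf.1.sub hg.1, fun x hx => by
    rw [vecLaplacian_sub hf.1 hg.1 hx, hf.2 x hx, hg.2 x hx, sub_zero]⟩

lemma HarmonicOutside.add (hf : HarmonicOutside R f) (hg : HarmonicOutside R g) :
    HarmonicOutside R (fun x => f x + g x) :=
  ⟨hf.1.add hg.1, fun x hx => by
    rw [vecLaplacian_add hf.1 hg.1 hx, hf.2 x hx, hg.2 x hx, add_zero]⟩

lemma HarmonicOutside.const_mul (c : ℝ) (hf : HarmonicOutside R f) :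
    HarmonicOutside R (fun x => c * f x) :=
  ⟨hf.1.const_mul c, fun x hx => by rw [vecLaplacian_const_mul c hf.1 hx, hf.2 x hx, mul_zero]⟩

lemma harmonicOutside_const (c : ℝ) :
    HarmonicOutside R (fun _ : EuclideanSpace ℝ (Fin n) => c) :=
  ⟨fun _ _ => contDiffAt_const, fun x _ => by simp [vecLaplacian]⟩

lemma SmoothOutside.eulerField (hf : SmoothOutside R f) : SmoothOutside R (eulerField f) :=
  SmoothOutside.sum fun l => (hf.partialDeriv l).coord_mul l

lemma SmoothOutside.rotationField (hf : SmoothOutside R f) (l i : Fin n) :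
    SmoothOutside R (rotationField l i f) :=
  ((hf.partialDeriv i).coord_mul l).sub ((hf.partialDeriv l).coord_mul i)

lemma HarmonicOutside.rotationField (hf : HarmonicOutside R f) (l i : Fin n) :
    HarmonicOutside R (rotationField l i f) := by
  refine ⟨hf.1.rotationField l i, fun x hx => ?_⟩
  have h1 := vecLaplacian_sub ((hf.1.partialDeriv i).coord_mul l)
    ((hf.1.partialDeriv l).coord_mul i) hx
  rw [vecLaplacian_coord_mul l (hf.1.partialDeriv i) hx,
    vecLaplacian_coord_mul i (hf.1.partialDeriv l) hx, (hf.partialDeriv i).2 x hx,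
    (hf.partialDeriv l).2 x hx, partialDeriv_comm hf.1 hx] at h1
  exact h1.trans (by ring)

lemma HarmonicOutside.eulerField (hf : HarmonicOutside R f) :
    HarmonicOutside R (eulerField f) := by
  refine ⟨hf.1.eulerField, fun x hx => ?_⟩
  have h1 := vecLaplacian_sum (fun l => (hf.1.partialDeriv l).coord_mul l) hx
  simp only [vecLaplacian_coord_mul _ (hf.1.partialDeriv _) hx, (hf.partialDeriv _).2 x hx,
    mul_zero, zero_add, ← Finset.mul_sum] at h1
  refine h1.trans ?_
  rw [← vecLaplacian_eq_sum, hf.2 x hx, mul_zero]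

lemma partialDeriv_eulerField (hf : SmoothOutside R f) (hx : R < ‖x‖) (i : Fin n) :
    partialDeriv i (eulerField f) x = partialDeriv i f x + eulerField (partialDeriv i f) x := by
  have h1 := partialDeriv_sum
    (fun l => ((hf.partialDeriv l).coord_mul l).differentiableAt hx) i
  simp only [partialDeriv_coord_mul _ ((hf.partialDeriv _).differentiableAt hx),
    Finset.sum_add_distrib, partialDeriv_comm hf hx i] at h1
  refine h1.trans ?_
  simp [eulerField]

lemma HarmonicOutside.kelvinField (hf : HarmonicOutside R f) (i : Fin n) :
    HarmonicOutside R (kelvinField i f) := by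
  have hrot := fun l => (hf.rotationField l i).1
  have he := hf.eulerField.add (hf.const_mul ((n : ℝ) - 2))
  have hs := SmoothOutside.sum fun l => (hrot l).coord_mul l
  refine ⟨hs.sub (he.1.coord_mul i), fun x hx => ?_⟩
  have h1 := vecLaplacian_sub hs (he.1.coord_mul i) hx
  rw [vecLaplacian_coord_mul i he.1 hx, he.2 x hx,
    vecLaplacian_sum (fun l => (hrot l).coord_mul l) hx,
    partialDeriv_add (hf.1.eulerField.differentiableAt hx)
      ((hf.1.const_mul _).differentiableAt hx),
    partialDeriv_const_mul _ (hf.1.differentiableAt hx), partialDeriv_eulerField hf.1 hx] at h1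
  have key : ∀ l, _root_.partialDeriv l (_root_.rotationField l i f) x
      = _root_.partialDeriv i f x + x l * _root_.partialDeriv l (_root_.partialDeriv i f) x
        - ((if i = l then 1 else 0) * _root_.partialDeriv l f x
          + x i * _root_.partialDeriv l (_root_.partialDeriv l f) x) := by
    intro l
    have h2 := partialDeriv_sub (((hf.1.partialDeriv i).coord_mul l).differentiableAt hx)
      (((hf.1.partialDeriv l).coord_mul i).differentiableAt hx) l
    rw [partialDeriv_coord_mul _ ((hf.1.partialDeriv _).differentiableAt hx),
      partialDeriv_coord_mul _ ((hf.1.partialDeriv _).differentiableAt hx), if_pos rfl,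
      one_mul] at h2
    exact h2
  have hz := hf.2 x hx
  rw [vecLaplacian_eq_sum] at hz
  simp only [vecLaplacian_coord_mul _ (hrot _) hx, (hf.rotationField _ i).2 x hx, key,
    mul_zero, zero_add, ← Finset.mul_sum, Finset.sum_sub_distrib, Finset.sum_add_distrib, hz] at h1
  refine h1.trans ?_
  simp [_root_.eulerField]
  ring

lemma norm_sq_eq_sum_coord (x : EuclideanSpace ℝ (Fin n)) : ∑ l, x l * x l = ‖x‖ ^ 2 := by
  simp only [EuclideanSpace.norm_sq_eq, Real.norm_eq_abs, sq_abs]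
  simp only [sq]

lemma norm_sq_mul_partialDeriv (i : Fin n) (f : EuclideanSpace ℝ (Fin n) → ℝ)
    (x : EuclideanSpace ℝ (Fin n)) :
    (∑ l, x l * (x l * partialDeriv i f x))
      = x i * eulerField f x + ∑ l, x l * rotationField l i f x := by
  simp only [eulerField, rotationField, Finset.mul_sum, ← Finset.sum_add_distrib]
  exact Finset.sum_congr rfl fun l _ => by ring

lemma sum_coord_mul_kelvinField (f : EuclideanSpace ℝ (Fin n) → ℝ)
    (x : EuclideanSpace ℝ (Fin n)) :
    ∑ i, x i * kelvinField i f x = -(‖x‖ ^ 2 * (eulerField f x + ((n : ℝ) - 2) * f x)) := by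
  have h0 : ∑ i, ∑ l, x i * (x l * rotationField l i f x) = 0 := by
    have h1 : ∑ i, ∑ l, x i * (x l * rotationField l i f x)
        = -∑ i, ∑ l, x i * (x l * rotationField l i f x) := by
      conv_lhs => rw [Finset.sum_comm]
      simp only [← Finset.sum_neg_distrib]
      refine Finset.sum_congr rfl fun i _ => Finset.sum_congr rfl fun l _ => ?_
      simp only [rotationField]
      ring
    linarith
  simp only [kelvinField, mul_sub, Finset.sum_sub_distrib, Finset.mul_sum, h0, zero_sub]
  simp only [← mul_assoc, ← Finset.sum_mul, norm_sq_eq_sum_coord]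

end ExteriorCalculus

section Decay

variable {n N : ℕ} {R a b : ℝ} {f g : EuclideanSpace ℝ (Fin n) → ℝ}

/-- All iterated partial derivatives of `f` of order `j ≤ N` are `O(|x| ^ (a - j))`. -/
def DecayUpTo : ℕ → (EuclideanSpace ℝ (Fin n) → ℝ) → ℝ → Prop
  | 0, f, a => f =O[cobounded _] fun x => ‖x‖ ^ a
  | N + 1, f, a => (f =O[cobounded _] fun x => ‖x‖ ^ a) ∧
      ∀ i, DecayUpTo N (partialDeriv i f) (a - 1)

lemma eventually_cobounded_lt_norm (R : ℝ) :
    ∀ᶠ x : EuclideanSpace ℝ (Fin n) in cobounded _, R < ‖x‖ :=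
  tendsto_norm_cobounded_atTop.eventually_gt_atTop R

lemma DecayUpTo.isBigO (h : DecayUpTo N f a) : f =O[cobounded _] fun x => ‖x‖ ^ a := by
  cases N with
  | zero => exact h
  | succ N => exact h.1

lemma DecayUpTo.of_succ (h : DecayUpTo (N + 1) f a) : DecayUpTo N f a := by
  induction N generalizing f a with
  | zero => exact h.1
  | succ N ih => exact ⟨h.1, fun i => ih (h.2 i)⟩

lemma isBigO_norm_rpow (hab : a ≤ b) :
    (fun x : EuclideanSpace ℝ (Fin n) => ‖x‖ ^ a) =O[cobounded _] fun x => ‖x‖ ^ b := by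
  refine IsBigO.of_bound 1 ?_
  filter_upwards [eventually_cobounded_lt_norm 1] with x hx
  rw [Real.norm_of_nonneg (by positivity), Real.norm_of_nonneg (by positivity), one_mul]
  exact Real.rpow_le_rpow_of_exponent_le hx.le hab

lemma isBigO_coord_mul (h : f =O[cobounded _] fun x => ‖x‖ ^ a) (l : Fin n) :
    (fun x => x l * f x) =O[cobounded _] fun x => ‖x‖ ^ (a + 1) := by
  have h1 : (fun x : EuclideanSpace ℝ (Fin n) => x l) =O[cobounded _] fun x => ‖x‖ :=
    IsBigO.of_bound 1 (Eventually.of_forall fun x => by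
      simpa using PiLp.norm_apply_le x l)
  refine (h1.mul h).congr' EventuallyEq.rfl ?_
  filter_upwards [eventually_cobounded_lt_norm 0] with x hx
  rw [Real.rpow_add_one hx.ne', mul_comm]

lemma DecayUpTo.congr (h : DecayUpTo N f a) (hfg : ∀ x, R < ‖x‖ → f x = g x) :
    DecayUpTo N g a := by
  have key : ∀ {f g : EuclideanSpace ℝ (Fin n) → ℝ} {a : ℝ}, (∀ x, R < ‖x‖ → f x = g x) →
      (f =O[cobounded _] fun x => ‖x‖ ^ a) → g =O[cobounded _] fun x => ‖x‖ ^ a :=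
    fun hfg h => h.congr' ((eventually_cobounded_lt_norm R).mono hfg) EventuallyEq.rfl
  induction N generalizing f g a with
  | zero => exact key hfg h
  | succ N ih =>
    exact ⟨key hfg h.1, fun i => ih (h.2 i) fun x hx => partialDeriv_congr hfg hx i⟩

lemma DecayUpTo.add (hf : DecayUpTo N f a) (hg : DecayUpTo N g a) (sf : SmoothOutside R f)
    (sg : SmoothOutside R g) : DecayUpTo N (fun x => f x + g x) a := by
  induction N generalizing f g a with
  | zero => exact IsBigO.add hf hg
  | succ N ih =>
    exact ⟨hf.1.add hg.1, fun i =>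
      (ih (hf.2 i) (hg.2 i) (sf.partialDeriv i) (sg.partialDeriv i)).congr (R := R) fun x hx =>
        (partialDeriv_add (sf.differentiableAt hx) (sg.differentiableAt hx) i).symm⟩

lemma DecayUpTo.const_mul (hf : DecayUpTo N f a) (sf : SmoothOutside R f) (c : ℝ) :
    DecayUpTo N (fun x => c * f x) a := by
  induction N generalizing f a with
  | zero => exact IsBigO.const_mul_left hf c
  | succ N ih =>
    exact ⟨hf.1.const_mul_left c, fun i =>
      (ih (hf.2 i) (sf.partialDeriv i)).congr (R := R) fun x hx =>
        (partialDeriv_const_mul c (sf.differentiableAt hx) i).symm⟩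

lemma DecayUpTo.sub (hf : DecayUpTo N f a) (hg : DecayUpTo N g a) (sf : SmoothOutside R f)
    (sg : SmoothOutside R g) : DecayUpTo N (fun x => f x - g x) a :=
  (hf.add (hg.const_mul sg (-1)) sf (sg.const_mul (-1))).congr (R := R) fun x _ => by ring

lemma DecayUpTo.sum {u : Fin n → EuclideanSpace ℝ (Fin n) → ℝ}
    (hu : ∀ l, DecayUpTo N (u l) a) (su : ∀ l, SmoothOutside R (u l)) :
    DecayUpTo N (fun x => ∑ l, u l x) a := by
  induction N generalizing u a with
  | zero => exact IsBigO.fun_sum fun l _ => hu l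
  | succ N ih =>
    exact ⟨IsBigO.fun_sum fun l _ => (hu l).1, fun i =>
      (ih (fun l => (hu l).2 i) fun l => (su l).partialDeriv i).congr (R := R) fun x hx =>
        (partialDeriv_sum (fun l => (su l).differentiableAt hx) i).symm⟩

lemma DecayUpTo.coord_mul (hf : DecayUpTo N f a) (sf : SmoothOutside R f) (l : Fin n) :
    DecayUpTo N (fun x => x l * f x) (a + 1) := by
  induction N generalizing f a with
  | zero => exact isBigO_coord_mul hf l
  | succ N ih =>
    refine ⟨isBigO_coord_mul hf.1 l, fun i => ?_⟩
    have h1 := ih (hf.2 i) (sf.partialDeriv i)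
    rw [sub_add_cancel] at h1
    rw [add_sub_cancel_right]
    exact ((hf.of_succ.const_mul sf (if l = i then 1 else 0)).add h1 (sf.const_mul _)
      ((sf.partialDeriv i).coord_mul l)).congr (R := R) fun x hx =>
        (partialDeriv_coord_mul l (sf.differentiableAt hx) i).symm

lemma DecayUpTo.coord_mul_partialDeriv (hf : DecayUpTo (N + 1) f a) (sf : SmoothOutside R f)
    (l i : Fin n) : DecayUpTo N (fun x => x l * partialDeriv i f x) a := by
  have h1 := (hf.2 i).coord_mul (sf.partialDeriv i) l
  rwa [sub_add_cancel] at h1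

lemma DecayUpTo.eulerField (hf : DecayUpTo (N + 1) f a) (sf : SmoothOutside R f) :
    DecayUpTo N (eulerField f) a :=
  DecayUpTo.sum (fun l => hf.coord_mul_partialDeriv sf l l) fun l => (sf.partialDeriv l).coord_mul l

lemma DecayUpTo.rotationField (hf : DecayUpTo (N + 1) f a) (sf : SmoothOutside R f)
    (l i : Fin n) : DecayUpTo N (rotationField l i f) a :=
  (hf.coord_mul_partialDeriv sf l i).sub (hf.coord_mul_partialDeriv sf i l)
    ((sf.partialDeriv i).coord_mul l) ((sf.partialDeriv l).coord_mul i)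

lemma DecayUpTo.kelvinField (hf : DecayUpTo (N + 1) f a) (sf : SmoothOutside R f) (i : Fin n) :
    DecayUpTo N (kelvinField i f) (a + 1) := by
  have hrot := fun l => (hf.rotationField sf l i).coord_mul (sf.rotationField l i) l
  have srot := fun l => (sf.rotationField l i).coord_mul l
  have he := (hf.eulerField sf).add (hf.of_succ.const_mul sf ((n : ℝ) - 2)) sf.eulerField
    (sf.const_mul _)
  have se := sf.eulerField.add (sf.const_mul ((n : ℝ) - 2))
  exact (DecayUpTo.sum hrot srot).sub (he.coord_mul se i) (SmoothOutside.sum srot) (se.coord_mul i)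

lemma DecayUpTo.of_norm_sq_mul (sf : SmoothOutside R f)
    (hf : DecayUpTo N (fun x => ∑ l, x l * (x l * f x)) (a + 2)) : DecayUpTo N f a := by
  have base : ∀ {f : EuclideanSpace ℝ (Fin n) → ℝ} {a : ℝ},
      ((fun x => ∑ l, x l * (x l * f x)) =O[cobounded _] fun x => ‖x‖ ^ (a + 2)) →
      f =O[cobounded _] fun x => ‖x‖ ^ a := by
    intro f a h
    have h2 : (fun x : EuclideanSpace ℝ (Fin n) => (‖x‖ ^ 2)⁻¹) =O[cobounded _]
        fun x => (‖x‖ ^ 2)⁻¹ := isBigO_refl _ _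
    refine (h2.mul h).congr' ?_ ?_
    all_goals
      filter_upwards [eventually_cobounded_lt_norm 0] with x hx
    · simp only [← mul_assoc, ← Finset.sum_mul, norm_sq_eq_sum_coord]
      field_simp
    · rw [Real.rpow_add hx, Real.rpow_two]
      field_simp
  induction N generalizing f a with
  | zero => exact base hf
  | succ N ih =>
    refine ⟨base hf.1, fun i => ih (sf.partialDeriv i) ?_⟩
    have h1 := ((ih sf hf.of_succ).const_mul sf 2).coord_mul (sf.const_mul 2) i
    have s2 := SmoothOutside.sum fun l => (sf.coord_mul l).coord_mul l
    have h3 := hf.2 i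
    rw [show a + 2 - 1 = a + 1 by ring] at h3
    rw [show a - 1 + 2 = a + 1 by ring]
    refine (h3.sub h1 (s2.partialDeriv i) ((sf.const_mul 2).coord_mul i)).congr (R := R)
      fun x hx => ?_
    rw [partialDeriv_sum fun l => ((sf.coord_mul l).coord_mul l).differentiableAt hx]
    simp only [partialDeriv_coord_mul _ ((sf.coord_mul _).differentiableAt hx),
      partialDeriv_coord_mul _ (sf.differentiableAt hx), mul_add, Finset.sum_add_distrib]
    simp
    ring

end Decay

section MaximumPrinciple

variable {n : ℕ} {R a b c : ℝ} {u v f : EuclideanSpace ℝ (Fin n) → ℝ}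
  {x : EuclideanSpace ℝ (Fin n)}

lemma hasDerivAt_comp_line (i : Fin n) (t : ℝ)
    (hv : DifferentiableAt ℝ v (x + t • EuclideanSpace.single i 1)) :
    HasDerivAt (fun s : ℝ => v (x + s • EuclideanSpace.single i 1))
      (partialDeriv i v (x + t • EuclideanSpace.single i 1)) t := by
  have h1 : HasDerivAt (fun s : ℝ => x + s • EuclideanSpace.single i (1 : ℝ))
      (EuclideanSpace.single i 1) t := by
    simpa using ((hasDerivAt_id t).smul_const (EuclideanSpace.single i (1 : ℝ))).const_add x
  exact hv.hasFDerivAt.comp_hasDerivAt t h1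

lemma partialDeriv_partialDeriv_nonpos_of_isLocalMax (sv : SmoothOutside R v) (hx : R < ‖x‖)
    (hmax : IsLocalMax v x) (i : Fin n) : partialDeriv i (partialDeriv i v) x ≤ 0 := by
  by_contra! hpos
  have hline : Continuous fun s : ℝ => x + s • EuclideanSpace.single i (1 : ℝ) := by fun_prop
  have hline0 : Tendsto (fun s : ℝ => x + s • EuclideanSpace.single i (1 : ℝ)) (𝓝 0) (𝓝 x) := by
    simpa using hline.tendsto 0
  set φ : ℝ → ℝ := fun s => v (x + s • EuclideanSpace.single i 1) with hφ
  have hev : deriv φ =ᶠ[𝓝 0] fun s => partialDeriv i v (x + s • EuclideanSpace.single i 1) := by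
    filter_upwards [hline0.eventually (eventually_nhds_exterior hx)] with s hs
    exact (hasDerivAt_comp_line i s (sv.differentiableAt hs)).deriv
  have hx0 : R < ‖x + (0 : ℝ) • EuclideanSpace.single i (1 : ℝ)‖ := by simpa using hx
  have hdd : deriv (deriv φ) 0 = partialDeriv i (partialDeriv i v) x := by
    rw [hev.deriv_eq,
      (hasDerivAt_comp_line i 0 ((sv.partialDeriv i).differentiableAt hx0)).deriv]
    simp
  have hlm : IsLocalMax φ 0 := by
    have := hline0.eventually hmax
    simpa [IsLocalMax, IsMaxFilter, hφ] using this
  have hmin : IsLocalMin φ 0 :=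
    isLocalMin_of_deriv_deriv_pos (hdd ▸ hpos) hlm.deriv_eq_zero
      (hasDerivAt_comp_line i 0 (sv.differentiableAt hx0)).continuousAt
  have hconst : φ =ᶠ[𝓝 0] fun _ => φ 0 := by
    filter_upwards [hlm, hmin] with s h1 h2 using le_antisymm h1 h2
  have : deriv (deriv φ) 0 = 0 := by
    rw [hconst.deriv.deriv_eq]
    simp
  linarith [hdd ▸ this]

lemma le_of_vecLaplacian_pos (sv : SmoothOutside R v) (hRa : R < a)
    (hΔ : ∀ x, R < ‖x‖ → 0 < vecLaplacian v x) (ha : ∀ x, ‖x‖ = a → v x ≤ c)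
    (hb : ∀ x, ‖x‖ = b → v x ≤ c) (hax : a ≤ ‖x‖) (hxb : ‖x‖ ≤ b) : v x ≤ c := by
  have hK : IsCompact {y : EuclideanSpace ℝ (Fin n) | a ≤ ‖y‖ ∧ ‖y‖ ≤ b} := by
    refine (isCompact_closedBall (0 : EuclideanSpace ℝ (Fin n)) b).of_isClosed_subset
      ((isClosed_le continuous_const continuous_norm).inter
        (isClosed_le continuous_norm continuous_const)) fun y hy => ?_
    simpa using hy.2
  obtain ⟨y, hy, hmax⟩ := hK.exists_isMaxOn ⟨x, hax, hxb⟩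
    (f := v) fun y hy => (sv.continuousAt (hRa.trans_le hy.1)).continuousWithinAt
  refine (hmax ⟨hax, hxb⟩ : v x ≤ v y).trans ?_
  rcases hy.1.eq_or_lt with h1 | h1
  · exact ha y h1.symm
  rcases hy.2.eq_or_lt with h2 | h2
  · exact hb y h2
  have hloc : IsLocalMax v y := by
    refine hmax.isLocalMax ?_
    filter_upwards [eventually_nhds_exterior h1,
      (isOpen_lt continuous_norm continuous_const).mem_nhds h2] with z hz1 hz2
    exact ⟨hz1.le, le_of_lt hz2⟩
  refine absurd (hΔ y (hRa.trans h1)) (not_lt.2 ?_)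
  exact Finset.sum_nonpos fun i _ =>
    partialDeriv_partialDeriv_nonpos_of_isLocalMax sv (hRa.trans h1) hloc i

lemma vecLaplacian_norm_sq (x : EuclideanSpace ℝ (Fin n)) :
    vecLaplacian (fun y : EuclideanSpace ℝ (Fin n) => ∑ l, y l * (y l * 1)) x = 2 * n := by
  have s1 : SmoothOutside (n := n) (-1) fun _ => 1 := (harmonicOutside_const 1).1
  have hx : -1 < ‖x‖ := by linarith [norm_nonneg x]
  rw [vecLaplacian_sum (fun l => (s1.coord_mul l).coord_mul l) hx]
  simp only [vecLaplacian_coord_mul _ (s1.coord_mul _) hx, vecLaplacian_coord_mul _ s1 hx,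
    partialDeriv_coord_mul _ (s1.differentiableAt hx), (harmonicOutside_const 1).2 x hx]
  simp [partialDeriv, mul_comm]

lemma HarmonicOutside.nonpos_of_boundary (hn : 0 < n) (hu : HarmonicOutside R u) (hRa : R < a)
    (ha : ∀ x, ‖x‖ = a → u x ≤ 0) (hb : ∀ x, ‖x‖ = b → u x ≤ 0) (hax : a ≤ ‖x‖)
    (hxb : ‖x‖ ≤ b) : u x ≤ 0 := by
  have key : ∀ ε > 0, u x ≤ ε * b ^ 2 := by
    intro ε hε
    have sq : SmoothOutside (n := n) R fun y => ∑ l, y l * (y l * 1) :=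
      SmoothOutside.sum fun l => (((harmonicOutside_const 1).1).coord_mul l).coord_mul l
    have hq : ∀ y : EuclideanSpace ℝ (Fin n), ∑ l, y l * (y l * 1) = ‖y‖ ^ 2 := by
      intro y; simp only [mul_one, norm_sq_eq_sum_coord]
    have hbd : ∀ y : EuclideanSpace ℝ (Fin n), ‖y‖ ≤ b → u y ≤ 0 →
        u y + ε * ∑ l, y l * (y l * 1) ≤ ε * b ^ 2 := by
      intro y hy h0
      rw [hq]
      have : ‖y‖ ^ 2 ≤ b ^ 2 := by gcongr
      nlinarith
    have h1 := le_of_vecLaplacian_pos (hu.1.add (sq.const_mul ε)) hRa (c := ε * b ^ 2)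
      (fun y hy => by
        rw [vecLaplacian_add hu.1 (sq.const_mul ε) hy, vecLaplacian_const_mul ε sq hy,
          vecLaplacian_norm_sq, hu.2 y hy]
        positivity)
      (fun y hy => hbd y (hy.le.trans (hax.trans hxb)) (ha y hy))
      (fun y hy => hbd y hy.le (hb y hy)) hax hxb
    rw [hq] at h1
    have : 0 ≤ ε * ‖x‖ ^ 2 := by positivity
    linarith
  by_contra! hpos
  have h1 := key (u x / (2 * (b ^ 2 + 1))) (by positivity)
  have h2 : u x / (2 * (b ^ 2 + 1)) * b ^ 2 < u x := by
    rw [div_mul_eq_mul_div, div_lt_iff₀ (by positivity)]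
    nlinarith [sq_nonneg b]
  linarith

lemma contDiffAt_norm_rpow (hx : x ≠ 0) (p : ℝ) :
    ContDiffAt ℝ ∞ (fun y : EuclideanSpace ℝ (Fin n) => ‖y‖ ^ p) x :=
  (contDiffAt_norm ℝ hx).rpow_const_of_ne (norm_ne_zero_iff.2 hx)

lemma partialDeriv_norm_rpow (hx : x ≠ 0) (p : ℝ) (i : Fin n) :
    partialDeriv i (fun y => ‖y‖ ^ p) x = p * (x i * ‖x‖ ^ (p - 2)) := by
  have h0 : ‖x‖ ^ 2 ≠ 0 := by positivity
  have e : (fun y : EuclideanSpace ℝ (Fin n) => ‖y‖ ^ p) = fun y => (‖y‖ ^ 2) ^ (p / 2) := by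
    ext y
    rw [← Real.rpow_natCast_mul (norm_nonneg y)]
    congr 1
    push_cast
    ring
  have h1 := (hasStrictFDerivAt_norm_sq x).hasFDerivAt.rpow_const (p := p / 2) (Or.inl h0)
  rw [partialDeriv, e, h1.fderiv]
  rw [← Real.rpow_natCast_mul (norm_nonneg x)]
  simp [EuclideanSpace.inner_single_right]
  rw [show 2 * (p / 2 - 1) = p - 2 by ring]
  ring

lemma harmonicOutside_norm_rpow (hR : 0 ≤ R) :
    HarmonicOutside (n := n) R fun y => ‖y‖ ^ (2 - n : ℝ) := by
  have hne : ∀ {y : EuclideanSpace ℝ (Fin n)}, R < ‖y‖ → y ≠ 0 := fun hy =>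
    norm_pos_iff.1 (hR.trans_lt hy)
  have hs : ∀ p : ℝ, SmoothOutside (n := n) R fun y => ‖y‖ ^ p := fun p y hy =>
    contDiffAt_norm_rpow (hne hy) p
  refine ⟨hs _, fun y hy => ?_⟩
  have key : ∀ (p : ℝ) i, partialDeriv i (partialDeriv i fun y => ‖y‖ ^ p) y
      = p * ‖y‖ ^ (p - 2) + p * (p - 2) * ((y i * y i) * ‖y‖ ^ (p - 2 - 2)) := by
    intro p i
    rw [partialDeriv_congr (fun z hz => partialDeriv_norm_rpow (hne hz) p i) hy,
      partialDeriv_const_mul _ (((hs _).coord_mul i).differentiableAt hy),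
      partialDeriv_coord_mul i ((hs _).differentiableAt hy), partialDeriv_norm_rpow (hne hy)]
    simp
    ring
  have hpos : 0 < ‖y‖ := hR.trans_lt hy
  rw [vecLaplacian_eq_sum]
  simp only [key, Finset.sum_add_distrib, ← Finset.mul_sum, ← Finset.sum_mul,
    norm_sq_eq_sum_coord]
  have hsq : ‖y‖ ^ 2 * ‖y‖ ^ (2 - n - 2 - 2 : ℝ) = ‖y‖ ^ (2 - n - 2 : ℝ) := by
    rw [Real.rpow_sub hpos (2 - n - 2) 2, Real.rpow_two]
    field_simp
  rw [hsq]
  simp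
  ring

end MaximumPrinciple

section Improvement

variable {n : ℕ} {R a p δ : ℝ} {f g : EuclideanSpace ℝ (Fin n) → ℝ}
  {x y : EuclideanSpace ℝ (Fin n)}

lemma exists_bound_of_isBigO {F : Type*} [SeminormedAddCommGroup F]
    {h : EuclideanSpace ℝ (Fin n) → F} (hh : h =O[cobounded _] fun x => ‖x‖ ^ p) (R : ℝ) :
    ∃ C > 0, ∃ r > R, ∀ x, r ≤ ‖x‖ → ‖h x‖ ≤ C * ‖x‖ ^ p := by
  obtain ⟨C, hC, hb⟩ := hh.exists_pos
  obtain ⟨r, -, hr⟩ := hasBasis_cobounded_norm.eventually_iff.1 hb.bound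
  refine ⟨C, hC, max r (R + 1), lt_max_of_lt_right (lt_add_one R), fun x hx => ?_⟩
  have := hr (show r ≤ ‖x‖ from (le_max_left _ _).trans hx)
  rwa [Real.norm_of_nonneg (by positivity : 0 ≤ ‖x‖ ^ p)] at this

lemma isBigO_of_bound {F : Type*} [SeminormedAddCommGroup F]
    {h : EuclideanSpace ℝ (Fin n) → F} (C r : ℝ)
    (hb : ∀ x, r ≤ ‖x‖ → ‖h x‖ ≤ C * ‖x‖ ^ p) : h =O[cobounded _] fun x => ‖x‖ ^ p := by
  refine IsBigO.of_bound C ?_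
  filter_upwards [eventually_cobounded_lt_norm r] with x hx
  rw [Real.norm_of_nonneg (by positivity : 0 ≤ ‖x‖ ^ p)]
  exact hb x hx.le

lemma SmoothOutside.exists_sphere_bound (sf : SmoothOutside R f) (ha : R < a) :
    ∃ M ≥ 0, ∀ x, ‖x‖ = a → |f x| ≤ M := by
  have hK : IsCompact {y : EuclideanSpace ℝ (Fin n) | ‖y‖ = a} := by
    simpa [Metric.sphere] using isCompact_sphere (0 : EuclideanSpace ℝ (Fin n)) a
  obtain ⟨M, hM⟩ := hK.exists_bound_of_continuousOn (f := f) fun y hy =>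
    (sf.continuousAt (ha.trans_eq (Eq.symm hy))).continuousWithinAt
  exact ⟨max M 0, le_max_right _ _, fun x hx => (hM x hx).trans (le_max_left _ _)⟩

lemma HarmonicOutside.isBigO_of_tendsto_zero (hn : 0 < n) (hR : 0 ≤ R)
    (hf : HarmonicOutside R f) (h0 : Tendsto f (cobounded _) (𝓝 0)) :
    f =O[cobounded _] fun x => ‖x‖ ^ (2 - n : ℝ) := by
  have hRa : R < R + 1 := lt_add_one R
  have ha : 0 < R + 1 := by linarith
  have hφ : (0 : ℝ) < (R + 1) ^ (2 - n : ℝ) := by positivity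
  obtain ⟨M, hM0, hM⟩ := hf.1.exists_sphere_bound hRa
  have key : ∀ g : EuclideanSpace ℝ (Fin n) → ℝ, HarmonicOutside R g →
      Tendsto g (cobounded _) (𝓝 0) → (∀ x, ‖x‖ = R + 1 → g x ≤ M) →
      ∀ x, R + 1 ≤ ‖x‖ → g x ≤ M / (R + 1) ^ (2 - n : ℝ) * ‖x‖ ^ (2 - n : ℝ) := by
    intro g hg hg0 hgM x hx
    refine le_of_forall_pos_le_add fun ε hε => ?_
    obtain ⟨r, -, hr⟩ := hasBasis_cobounded_norm.eventually_iff.1 (hg0.eventually_lt_const hε)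
    have hbar := ((harmonicOutside_norm_rpow hR).const_mul (M / (R + 1) ^ (2 - n : ℝ))).add
      (harmonicOutside_const (n := n) ε)
    have := (hg.sub hbar).nonpos_of_boundary hn hRa (b := max r ‖x‖) (x := x) ?_ ?_ hx
      (le_max_right _ _)
    · linarith
    · intro y hy
      rw [hy, div_mul_cancel₀ _ hφ.ne']
      linarith [hgM y hy]
    · intro y hy
      have h1 : g y < ε := hr (show r ≤ ‖y‖ from hy ▸ le_max_left _ _)
      have h2 : 0 ≤ M / (R + 1) ^ (2 - n : ℝ) * ‖y‖ ^ (2 - n : ℝ) := by positivity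
      linarith
  refine isBigO_of_bound (M / (R + 1) ^ (2 - n : ℝ)) (R + 1) fun x hx => abs_le.2 ⟨?_, ?_⟩
  · have := key (fun x => (-1) * f x) (hf.const_mul (-1))
      (by simpa using h0.const_mul (-1)) (fun y hy => by linarith [abs_le.1 (hM y hy)]) x hx
    linarith
  · exact key f hf h0 (fun y hy => (abs_le.1 (hM y hy)).2) x hx

lemma tendsto_zero_of_isBigO (hf : f =O[cobounded _] fun x => ‖x‖ ^ δ) (hδ : δ < 0) :
    Tendsto f (cobounded _) (𝓝 0) := by
  refine hf.trans_tendsto ?_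
  have := (tendsto_rpow_neg_atTop (neg_pos.2 hδ)).comp
    (tendsto_norm_cobounded_atTop (E := EuclideanSpace ℝ (Fin n)))
  simpa [Function.comp_def] using this

lemma clm_apply_eq_sum {F : Type*} [NormedAddCommGroup F] [NormedSpace ℝ F]
    (L : EuclideanSpace ℝ (Fin n) →L[ℝ] F) (v : EuclideanSpace ℝ (Fin n)) :
    L v = ∑ i, v i • L (EuclideanSpace.single i 1) := by
  conv_lhs => rw [← (EuclideanSpace.basisFun (Fin n) ℝ).sum_repr v]
  simp [map_sum]

lemma eulerField_eq_fderiv (f : EuclideanSpace ℝ (Fin n) → ℝ) (x : EuclideanSpace ℝ (Fin n)) :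
    eulerField f x = fderiv ℝ f x x := by
  rw [clm_apply_eq_sum (fderiv ℝ f x) x]
  rfl

lemma norm_fderiv_le_sum (f : EuclideanSpace ℝ (Fin n) → ℝ) (x : EuclideanSpace ℝ (Fin n)) :
    ‖fderiv ℝ f x‖ ≤ ∑ i, ‖partialDeriv i f x‖ := by
  refine ContinuousLinearMap.opNorm_le_bound _ (by positivity) fun v => ?_
  rw [clm_apply_eq_sum (fderiv ℝ f x) v, Finset.sum_mul]
  refine norm_sum_le_of_le _ fun i _ => ?_
  rw [norm_smul, mul_comm]
  exact mul_le_mul_of_nonneg_left (PiLp.norm_apply_le v i) (norm_nonneg _)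

lemma isBigO_fderiv (h : ∀ i, partialDeriv i f =O[cobounded _] fun x => ‖x‖ ^ p) :
    (fderiv ℝ f) =O[cobounded _] fun x => ‖x‖ ^ p := by
  have h1 : (fun x => ∑ i, ‖partialDeriv i f x‖) =O[cobounded _] fun x => ‖x‖ ^ p :=
    IsBigO.fun_sum fun i _ => (h i).norm_left
  refine (IsBigO.of_bound 1 (Eventually.of_forall fun x => ?_)).trans h1
  rw [one_mul, Real.norm_of_nonneg (by positivity)]
  exact norm_fderiv_le_sum f x

lemma SmoothOutside.isBigO_of_partialDeriv (sf : SmoothOutside R f) (hR : 0 ≤ R) (hp : 0 ≤ p)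
    (h : ∀ i, _root_.partialDeriv i f =O[cobounded _] fun x => ‖x‖ ^ p) :
    f =O[cobounded _] fun x => ‖x‖ ^ (p + 1) := by
  obtain ⟨C, hC, r, hr, hb⟩ := exists_bound_of_isBigO (isBigO_fderiv h) (max R 1)
  have hRr : R < r := (le_max_left _ _).trans_lt hr
  have hr1 : 1 < r := (le_max_right _ _).trans_lt hr
  obtain ⟨M, hM0, hM⟩ := sf.exists_sphere_bound hRr
  refine isBigO_of_bound (M + C) r fun x hx => ?_
  have hx0 : 0 < ‖x‖ := by linarith
  have hrx : r / ‖x‖ ≤ 1 := (div_le_one hx0).2 hx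
  have hz : ‖(r / ‖x‖) • x‖ = r := by
    rw [norm_smul, Real.norm_of_nonneg (by positivity), div_mul_cancel₀ _ hx0.ne']
  have hseg : ∀ y ∈ segment ℝ ((r / ‖x‖) • x) x, r ≤ ‖y‖ ∧ ‖y‖ ≤ ‖x‖ := by
    rintro y ⟨s, t, hs, ht, hst, rfl⟩
    rw [smul_smul, ← add_smul, norm_smul, Real.norm_of_nonneg (by positivity), add_mul, mul_assoc,
      div_mul_cancel₀ _ hx0.ne']
    constructor <;> nlinarith
  have h1 := Convex.norm_image_sub_le_of_norm_fderiv_le (𝕜 := ℝ) (f := f) (C := C * ‖x‖ ^ p)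
    (fun y hy => sf.differentiableAt (hRr.trans_le (hseg y hy).1))
    (fun y hy => (hb y (hseg y hy).1).trans (by
      have := (hseg y hy).2
      gcongr))
    (convex_segment _ _) (left_mem_segment ℝ ((r / ‖x‖) • x) x) (right_mem_segment ℝ _ x)
  have h2 : ‖x - (r / ‖x‖) • x‖ ≤ ‖x‖ := by
    have : x - (r / ‖x‖) • x = (1 - r / ‖x‖) • x := by rw [sub_smul, one_smul]
    rw [this, norm_smul, Real.norm_of_nonneg (by linarith)]
    have : 0 ≤ r / ‖x‖ := by positivity
    nlinarith
  have h3 : (1 : ℝ) ≤ ‖x‖ ^ (p + 1) := Real.one_le_rpow (by linarith) (by linarith)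
  have h4 : C * ‖x‖ ^ p * ‖x - (r / ‖x‖) • x‖ ≤ C * ‖x‖ ^ (p + 1) := by
    rw [Real.rpow_add_one hx0.ne', ← mul_assoc]
    gcongr
  have h5 : ‖f ((r / ‖x‖) • x)‖ ≤ M := hM _ hz
  have h6 := norm_le_norm_add_norm_sub' (f x) (f ((r / ‖x‖) • x))
  nlinarith

lemma half_norm_le_of_mem_segment (hxy : ‖x‖ = ‖y‖) (ho : inner ℝ x y = 0)
    {z : EuclideanSpace ℝ (Fin n)} (hz : z ∈ segment ℝ x y) : ‖x‖ / 2 ≤ ‖z‖ := by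
  obtain ⟨s, t, hs, ht, hst, rfl⟩ := hz
  refine le_of_sq_le_sq ?_ (norm_nonneg _)
  rw [@norm_add_sq_real, inner_smul_left, inner_smul_right, ho, norm_smul, norm_smul, ← hxy,
    Real.norm_of_nonneg hs, Real.norm_of_nonneg ht]
  have : t = 1 - s := by linarith
  subst this
  simp
  nlinarith [mul_nonneg (sq_nonneg (2 * s - 1)) (sq_nonneg ‖x‖), sq_nonneg ‖x‖]

lemma exists_orthogonal_of_norm_eq (hn : 3 ≤ n) (x y : EuclideanSpace ℝ (Fin n)) :
    ∃ z : EuclideanSpace ℝ (Fin n), ‖z‖ = ‖x‖ ∧ inner ℝ x z = 0 ∧ inner ℝ z y = 0 := by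
  have hne : (Submodule.span ℝ ((({x, y} : Finset (EuclideanSpace ℝ (Fin n)))) :
      Set (EuclideanSpace ℝ (Fin n))))ᗮ ≠ ⊥ := by
    intro h
    rw [Submodule.orthogonal_eq_bot_iff] at h
    have h1 := finrank_span_finset_le_card (R := ℝ)
      ({x, y} : Finset (EuclideanSpace ℝ (Fin n)))
    rw [Set.finrank, h, finrank_top, finrank_euclideanSpace_fin] at h1
    have := Finset.card_le_two (a := x) (b := y)
    omega
  obtain ⟨z, hz, hz0⟩ := Submodule.exists_mem_ne_zero_of_ne_bot hne
  rw [Submodule.mem_orthogonal] at hz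
  have hx := hz x (Submodule.subset_span (by simp))
  have hy := hz y (Submodule.subset_span (by simp))
  refine ⟨(‖x‖ / ‖z‖) • z, ?_, ?_, ?_⟩
  · rw [norm_smul, Real.norm_of_nonneg (by positivity),
      div_mul_cancel₀ _ (norm_ne_zero_iff.2 hz0)]
  · rw [inner_smul_right, hx, mul_zero]
  · rw [inner_smul_left, real_inner_comm, hy, mul_zero]

/-- A harmonic function on the exterior of a ball whose oscillation over spheres is bounded is
bounded from above, by comparison with the barrier `1 - (|x| / a) ^ (2 - n)`. -/
lemma HarmonicOutside.bddAbove_of_sphere_oscillation (hn : 3 ≤ n) (hR : 0 ≤ R) {K : ℝ}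
    (hf : HarmonicOutside R f) (ha : R < a)
    (hK : ∀ x y, 2 * a ≤ ‖x‖ → ‖y‖ = ‖x‖ → f x - f y ≤ K) :
    ∃ B, ∀ x, 2 * a ≤ ‖x‖ → f x ≤ B := by
  have ha0 : 0 < a := hR.trans_lt ha
  obtain ⟨M, hM0, hM⟩ := hf.1.exists_sphere_bound ha
  obtain ⟨M₂, hM₂0, hM₂⟩ := hf.1.exists_sphere_bound (show R < 2 * a by linarith)
  refine ⟨K + 2 * M₂ + M, fun x hx => ?_⟩
  by_cases ht : f x - K ≤ -M
  · linarith
  have hx0 : 0 < ‖x‖ := by linarith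
  have hpos : 0 < f x - K + M := by linarith
  have hφ : (0 : ℝ) < a ^ (2 - n : ℝ) := by positivity
  have hbar := ((harmonicOutside_const (n := n) (R := R) (f x - K)).sub
    ((harmonicOutside_norm_rpow hR).const_mul ((f x - K + M) / a ^ (2 - n : ℝ)))).sub hf
  have hpn : ‖(2 * a / ‖x‖) • x‖ = 2 * a := by
    rw [norm_smul, Real.norm_of_nonneg (by positivity), div_mul_cancel₀ _ hx0.ne']
  have h1 := hbar.nonpos_of_boundary (by omega) ha (b := ‖x‖) (x := (2 * a / ‖x‖) • x)
    ?_ ?_ (by rw [hpn]; linarith) (by rw [hpn]; exact hx)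
  · rw [hpn, Real.mul_rpow zero_le_two ha0.le] at h1
    have h2 : (2 : ℝ) ^ (2 - n : ℝ) ≤ 1 / 2 := by
      have h3 : (2 : ℝ) ^ (2 - n : ℝ) ≤ 2 ^ (-1 : ℝ) := by
        have : (3 : ℝ) ≤ n := by exact_mod_cast hn
        exact Real.rpow_le_rpow_of_exponent_le one_le_two (by linarith)
      rwa [Real.rpow_neg_one, ← one_div] at h3
    have h4 : (f x - K + M) / a ^ (2 - n : ℝ) * (2 ^ (2 - n : ℝ) * a ^ (2 - n : ℝ))
        = (f x - K + M) * 2 ^ (2 - n : ℝ) := by field_simp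
    rw [h4] at h1
    have h5 := (abs_le.1 (hM₂ _ hpn)).2
    nlinarith
  · intro y hy
    rw [hy, div_mul_cancel₀ _ hφ.ne']
    linarith [(abs_le.1 (hM y hy)).1]
  · intro y hy
    have h2 : 0 ≤ (f x - K + M) / a ^ (2 - n : ℝ) * ‖y‖ ^ (2 - n : ℝ) := by positivity
    linarith [hK x y hx hy]

lemma HarmonicOutside.isBigO_one_of_partialDeriv (hn : 3 ≤ n) (hR : 0 ≤ R)
    (hf : HarmonicOutside R f)
    (h : ∀ i, _root_.partialDeriv i f =O[cobounded _] fun x => ‖x‖ ^ (-1 : ℝ)) :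
    f =O[cobounded _] fun x => ‖x‖ ^ (0 : ℝ) := by
  obtain ⟨C, hC, r, hRr, hb⟩ := exists_bound_of_isBigO (isBigO_fderiv h) R
  have hr0 : 0 < r := hR.trans_lt hRr
  have horth : ∀ x y, 2 * r ≤ ‖x‖ → ‖y‖ = ‖x‖ → inner ℝ x y = 0 → |f y - f x| ≤ 4 * C := by
    intro x y hx hxy ho
    have hseg := fun z => half_norm_le_of_mem_segment hxy.symm ho (z := z)
    have hx0 : 0 < ‖x‖ := by linarith
    have h1 := Convex.norm_image_sub_le_of_norm_fderiv_le (𝕜 := ℝ) (f := f)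
      (C := C * (‖x‖ / 2)⁻¹)
      (fun z hz => hf.1.differentiableAt (hRr.trans_le (by linarith [hseg z hz])))
      (fun z hz => (hb z (by linarith [hseg z hz])).trans (by
        have := hseg z hz
        rw [Real.rpow_neg_one]
        gcongr))
      (convex_segment _ _) (left_mem_segment ℝ x y) (right_mem_segment ℝ x y)
    refine h1.trans ?_
    have h2 : ‖y - x‖ ≤ 2 * ‖x‖ := (norm_sub_le _ _).trans (by linarith)
    calc C * (‖x‖ / 2)⁻¹ * ‖y - x‖ ≤ C * (‖x‖ / 2)⁻¹ * (2 * ‖x‖) := by gcongr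
      _ = 4 * C := by field_simp; norm_num
  have hosc : ∀ x y, 2 * r ≤ ‖x‖ → ‖y‖ = ‖x‖ → |f x - f y| ≤ 8 * C := by
    intro x y hx hxy
    obtain ⟨z, hz, hxz, hzy⟩ := exists_orthogonal_of_norm_eq hn x y
    have h1 := abs_le.1 (horth x z hx hz hxz)
    have h2 := abs_le.1 (horth z y (hz ▸ hx) (hxy.trans hz.symm) hzy)
    exact abs_le.2 ⟨by linarith, by linarith⟩
  obtain ⟨B, hB⟩ := hf.bddAbove_of_sphere_oscillation hn hR hRr
    fun x y hx hxy => (abs_le.1 (hosc x y hx hxy)).2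
  obtain ⟨B', hB'⟩ := (hf.const_mul (-1)).bddAbove_of_sphere_oscillation hn hR hRr
    (K := 8 * C) fun x y hx hxy => by linarith [(abs_le.1 (hosc x y hx hxy)).1]
  refine isBigO_of_bound (max B B') (2 * r) fun x hx => ?_
  rw [Real.rpow_zero, mul_one]
  exact abs_le.2 ⟨by linarith [hB' x hx, le_max_right B B'], (hB x hx).trans (le_max_left _ _)⟩

end Improvement

section ExceptionalRates

variable {n : ℕ} {R p δ : ℝ} {f : EuclideanSpace ℝ (Fin n) → ℝ}

lemma isBigO_eulerField_add_of_kelvinField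
    (h : ∀ i, kelvinField i f =O[cobounded _] fun x => ‖x‖ ^ p) :
    (fun x => eulerField f x + ((n : ℝ) - 2) * f x) =O[cobounded _] fun x => ‖x‖ ^ (p - 1) := by
  have h1 : (fun x => ∑ i, x i * kelvinField i f x) =O[cobounded _] fun x => ‖x‖ ^ (p + 1) :=
    IsBigO.fun_sum fun i _ => isBigO_coord_mul (h i) i
  have h2 : (fun x : EuclideanSpace ℝ (Fin n) => (‖x‖ ^ 2)⁻¹) =O[cobounded _]
      fun x => (‖x‖ ^ 2)⁻¹ := isBigO_refl _ _
  refine (h2.mul h1.neg_left).congr' ?_ ?_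
  all_goals
    filter_upwards [eventually_cobounded_lt_norm 0] with x hx
  · rw [sum_coord_mul_kelvinField]
    field_simp
  · rw [show p + 1 = p - 1 + 2 by ring, Real.rpow_add hx, Real.rpow_two]
    field_simp

lemma hasDerivAt_rpow_mul_comp_smul (q : ℝ) {t : ℝ} (ht : 0 < t) {x : EuclideanSpace ℝ (Fin n)}
    (hf : DifferentiableAt ℝ f (t • x)) :
    HasDerivAt (fun s : ℝ => s ^ q * f (s • x))
      (t ^ (q - 1) * (eulerField f (t • x) + q * f (t • x))) t := by
  have h1 : HasDerivAt (fun s : ℝ => s • x) x t := by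
    simpa using (hasDerivAt_id t).smul_const x
  have h2 := (Real.hasDerivAt_rpow_const (p := q) (Or.inl ht.ne')).mul
    (hf.hasFDerivAt.comp_hasDerivAt t h1)
  refine h2.congr_deriv ?_
  have h3 : t ^ q = t ^ (q - 1) * t := by rw [← Real.rpow_add_one ht.ne', sub_add_cancel]
  rw [eulerField_eq_fderiv, map_smul, smul_eq_mul, h3]
  simp
  ring

/-- Radial integration from infinity: the operators `kelvinField i` control `f` with a gain of one
power of `|x|`. -/
lemma SmoothOutside.isBigO_of_kelvinField (sf : SmoothOutside R f) (hR : 0 ≤ R)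
    (hp : p ≤ 2 - n) (hδ : δ < 2 - n) (hfδ : f =O[cobounded _] fun x => ‖x‖ ^ δ)
    (h : ∀ i, kelvinField i f =O[cobounded _] fun x => ‖x‖ ^ p) :
    f =O[cobounded _] fun x => ‖x‖ ^ (p - 1) := by
  obtain ⟨C, hC, r, hRr, hb⟩ := exists_bound_of_isBigO (isBigO_eulerField_add_of_kelvinField h) R
  have hr0 : 0 < r := hR.trans_lt hRr
  refine isBigO_of_bound C r fun x hx => ?_
  have hx0 : 0 < ‖x‖ := hr0.trans_le hx
  have hnorm : ∀ {t : ℝ}, 1 ≤ t → ‖t • x‖ = t * ‖x‖ := fun ht => by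
    rw [norm_smul, Real.norm_of_nonneg (by linarith)]
  have hle : ∀ {t : ℝ}, 1 ≤ t → r ≤ ‖t • x‖ := fun ht => by rw [hnorm ht]; nlinarith
  set q : ℝ := n - 2 with hq
  have hg : ∀ t : ℝ, 1 ≤ t → HasDerivAt (fun s : ℝ => s ^ q * f (s • x))
      (t ^ (q - 1) * (_root_.eulerField f (t • x) + q * f (t • x))) t := fun t ht =>
    hasDerivAt_rpow_mul_comp_smul q (by linarith)
      (sf.differentiableAt (hRr.trans_le (hle ht)))
  have hk : ∀ t : ℝ, 1 ≤ t → HasDerivAt (fun s : ℝ => C * ‖x‖ ^ (p - 1) * s ^ (q + (p - 1)))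
      (C * ‖x‖ ^ (p - 1) * ((q + (p - 1)) * t ^ (q + (p - 1) - 1))) t := fun t ht =>
    (Real.hasDerivAt_rpow_const (Or.inl (by linarith))).const_mul _
  have hbd : ∀ t : ℝ, 1 ≤ t → |t ^ (q - 1) * (_root_.eulerField f (t • x) + q * f (t • x))|
      ≤ C * ‖x‖ ^ (p - 1) * t ^ (q + (p - 1) - 1) := by
    intro t ht
    have ht0 : 0 < t := by linarith
    have h1 := hb (t • x) (hle ht)
    rw [hnorm ht, Real.mul_rpow ht0.le hx0.le] at h1
    rw [abs_mul, abs_of_pos (by positivity), show q + (p - 1) - 1 = q - 1 + (p - 1) by ring,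
      Real.rpow_add ht0]
    calc _ ≤ t ^ (q - 1) * (C * (t ^ (p - 1) * ‖x‖ ^ (p - 1))) := by gcongr; exact h1
      _ = _ := by ring
  have hg0 : Tendsto (fun s : ℝ => s ^ q * f (s • x)) atTop (𝓝 0) := by
    obtain ⟨C', hC', r', hr', hb'⟩ := exists_bound_of_isBigO hfδ 0
    have hlim : Tendsto (fun s : ℝ => C' * ‖x‖ ^ δ * s ^ (q + δ)) atTop (𝓝 0) := by
      have := (tendsto_rpow_neg_atTop (show 0 < -(q + δ) by linarith)).const_mul (C' * ‖x‖ ^ δ)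
      simpa using this
    refine squeeze_zero_norm' ?_ hlim
    filter_upwards [eventually_ge_atTop 1, eventually_ge_atTop (r' / ‖x‖)] with s hs1 hs2
    have hs0 : 0 < s := by linarith
    have h1 := hb' (s • x) (by rw [hnorm hs1]; exact (div_le_iff₀ hx0).1 hs2)
    rw [hnorm hs1, Real.mul_rpow hs0.le hx0.le] at h1
    rw [norm_mul, Real.norm_of_nonneg (by positivity), Real.rpow_add hs0]
    calc _ ≤ s ^ q * (C' * (s ^ δ * ‖x‖ ^ δ)) := by gcongr
      _ = _ := by ring
  have hk0 : Tendsto (fun s : ℝ => C * ‖x‖ ^ (p - 1) * s ^ (q + (p - 1))) atTop (𝓝 0) := by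
    have := (tendsto_rpow_neg_atTop (show 0 < -(q + (p - 1)) by linarith)).const_mul
      (C * ‖x‖ ^ (p - 1))
    simpa using this
  have key : ∀ σ : ℝ, |σ| = 1 → 0 ≤ σ * f x + C * ‖x‖ ^ (p - 1) := by
    intro σ hσ
    have hd : ∀ t : ℝ, 1 ≤ t → HasDerivAt
        (fun s : ℝ => σ * (s ^ q * f (s • x)) + C * ‖x‖ ^ (p - 1) * s ^ (q + (p - 1))) _ t :=
      fun t ht => ((hg t ht).const_mul σ).add (hk t ht)
    have hanti : AntitoneOn (fun s : ℝ => σ * (s ^ q * f (s • x))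
        + C * ‖x‖ ^ (p - 1) * s ^ (q + (p - 1))) (Set.Ici 1) := by
      refine antitoneOn_of_deriv_nonpos (convex_Ici 1)
        (fun t ht => (hd t ht).continuousAt.continuousWithinAt)
        (fun t ht => (hd t (interior_subset ht)).differentiableAt.differentiableWithinAt)
        fun t ht => ?_
      have ht1 : (1 : ℝ) ≤ t := interior_subset ht
      rw [(hd t ht1).deriv]
      have h1 : σ * (t ^ (q - 1) * (_root_.eulerField f (t • x) + q * f (t • x)))
          ≤ C * ‖x‖ ^ (p - 1) * t ^ (q + (p - 1) - 1) := by
        refine (le_abs_self _).trans ?_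
        rw [abs_mul, hσ, one_mul]
        exact hbd t ht1
      have h2 : 0 ≤ C * ‖x‖ ^ (p - 1) * t ^ (q + (p - 1) - 1) := by
        have : (0 : ℝ) < t := by linarith
        positivity
      nlinarith
    have hlim := (hg0.const_mul σ).add hk0
    rw [mul_zero, zero_add] at hlim
    have := le_of_tendsto hlim ((eventually_ge_atTop 1).mono fun t ht =>
      hanti (Set.self_mem_Ici) ht ht)
    simpa using this
  exact abs_le.2 ⟨by linarith [key 1 (by simp)], by linarith [key (-1) (by simp)]⟩

lemma HarmonicOutside.isBigO_of_lt_low (hn : 3 ≤ n) (hR : 0 ≤ R) (m : ℕ)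
    (hf : HarmonicOutside R f) (hd : ∀ N, DecayUpTo N f δ) (hδ : δ < 3 - n - m) :
    f =O[cobounded _] fun x => ‖x‖ ^ (2 - n - m : ℝ) := by
  have hn' : (3 : ℝ) ≤ n := by exact_mod_cast hn
  induction m generalizing f δ with
  | zero =>
    rw [Nat.cast_zero, sub_zero] at hδ ⊢
    exact hf.isBigO_of_tendsto_zero (by omega) hR
      (tendsto_zero_of_isBigO (hd 0).isBigO (by linarith))
  | succ m ih =>
    have hm : (0 : ℝ) ≤ m := m.cast_nonneg
    push_cast at hδ ⊢
    have h1 := hf.1.isBigO_of_kelvinField hR (p := 2 - n - m) (by linarith)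
      (show δ < 2 - n by linarith) (hd 0).isBigO fun i =>
        ih (hf.kelvinField i) (fun N => (hd (N + 1)).kelvinField hf.1 i) (by linarith)
    rwa [← sub_sub]

lemma HarmonicOutside.isBigO_of_lt_high (hn : 3 ≤ n) (hR : 0 ≤ R) (m : ℕ)
    (hf : HarmonicOutside R f) (hd : ∀ N, DecayUpTo N f δ) (hδ : δ < m + 1) :
    f =O[cobounded _] fun x => ‖x‖ ^ (m : ℝ) := by
  have hn' : (3 : ℝ) ≤ n := by exact_mod_cast hn
  induction m generalizing f δ with
  | zero =>
    rw [Nat.cast_zero] at hδ ⊢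
    refine hf.isBigO_one_of_partialDeriv hn hR fun i => ?_
    exact ((hf.partialDeriv i).isBigO_of_tendsto_zero (by omega) hR
      (tendsto_zero_of_isBigO ((hd 1).2 i).isBigO (by linarith))).trans
        (isBigO_norm_rpow (by linarith))
  | succ m ih =>
    push_cast at hδ ⊢
    exact hf.1.isBigO_of_partialDeriv hR m.cast_nonneg fun i =>
      ih (hf.partialDeriv i) (fun N => (hd (N + 1)).2 i) (by linarith)

/-- A pointwise rate valid for all harmonic functions with decay rate `δ` also holds, with the
corresponding shift, for their derivatives, because `|x|² ∂ᵢ` is a combination with linear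
coefficients of the Euler field and the rotation fields, which preserve this class. -/
lemma decayUpTo_of_forall_isBigO (h : ∀ f : EuclideanSpace ℝ (Fin n) → ℝ, HarmonicOutside R f →
      (∀ N, DecayUpTo N f δ) → f =O[cobounded _] fun x => ‖x‖ ^ p)
    (hf : HarmonicOutside R f) (hd : ∀ N, DecayUpTo N f δ) (N : ℕ) : DecayUpTo N f p := by
  induction N generalizing f with
  | zero => exact h f hf hd
  | succ N ih =>
    refine ⟨h f hf hd, fun i => DecayUpTo.of_norm_sq_mul (R := R) (hf.1.partialDeriv i) ?_⟩
    rw [show p - 1 + 2 = p + 1 by ring]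
    simp only [norm_sq_mul_partialDeriv]
    have se := hf.1.eulerField
    have sr := fun l => hf.1.rotationField l i
    exact ((ih hf.eulerField fun N => (hd (N + 1)).eulerField hf.1).coord_mul se i).add
      (DecayUpTo.sum (fun l => (ih (hf.rotationField l i) fun N =>
        (hd (N + 1)).rotationField hf.1 l i).coord_mul (sr l) l) fun l => (sr l).coord_mul l)
      (se.coord_mul i) (SmoothOutside.sum fun l => (sr l).coord_mul l)

lemma norm_iteratedFDeriv_partialDeriv_le (sf : SmoothOutside R f) (i : Fin n) (j : ℕ)
    {x : EuclideanSpace ℝ (Fin n)} (hx : R < ‖x‖) :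
    ‖iteratedFDeriv ℝ j (partialDeriv i f) x‖ ≤ ‖iteratedFDeriv ℝ (j + 1) f x‖ := by
  have h1 : ContDiffAt ℝ j (fderiv ℝ f) x :=
    ((sf x hx).fderiv_right (m := ∞) (by simp)).of_le (by exact_mod_cast le_top)
  have := norm_iteratedFDeriv_clm_apply_const (c := EuclideanSpace.single i (1 : ℝ)) h1 le_rfl
  rw [← norm_iteratedFDeriv_fderiv]
  rw [show ‖EuclideanSpace.single i (1 : ℝ)‖ = 1 by simp, one_mul] at this
  exact this

lemma norm_iteratedFDeriv_succ_le_sum (sf : SmoothOutside R f) (j : ℕ)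
    {x : EuclideanSpace ℝ (Fin n)} (hx : R < ‖x‖) :
    ‖iteratedFDeriv ℝ (j + 1) f x‖
      ≤ ∑ i : Fin n, ‖ContinuousLinearMap.smulRightL ℝ (EuclideanSpace ℝ (Fin n)) ℝ
          (EuclideanSpace.proj i)‖ * ‖iteratedFDeriv ℝ j (partialDeriv i f) x‖ := by
  have e : fderiv ℝ f = fun y => ∑ i : Fin n, ContinuousLinearMap.smulRightL ℝ
      (EuclideanSpace ℝ (Fin n)) ℝ (EuclideanSpace.proj i) (partialDeriv i f y) := by
    ext y v
    rw [clm_apply_eq_sum (fderiv ℝ f y) v]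
    simp [partialDeriv]
  have hj : ∀ i, ContDiffAt ℝ j (partialDeriv i f) x := fun i =>
    (sf.partialDeriv i x hx).of_le (by exact_mod_cast le_top)
  rw [← norm_iteratedFDeriv_fderiv, e, iteratedFDeriv_fun_sum_apply]
  · exact norm_sum_le_of_le _ fun i _ =>
      ContinuousLinearMap.norm_iteratedFDeriv_comp_left _ (hj i) le_rfl
  · exact fun i _ => (ContinuousLinearMap.contDiff _).contDiffAt.comp x (hj i)

lemma isBigO_iteratedFDeriv_iff (sf : SmoothOutside R f) :
    (∀ N, DecayUpTo N f δ) ↔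
      ∀ j : ℕ, (iteratedFDeriv ℝ j f) =O[cobounded _] fun x => ‖x‖ ^ (δ - j) := by
  constructor
  · intro h j
    induction j generalizing f δ with
    | zero =>
      rw [Nat.cast_zero, sub_zero]
      exact (IsBigO.of_norm_norm (by simpa using (isBigO_refl _ _))).trans (h 0).isBigO
    | succ j ih =>
      have h1 := fun i => (ih (sf.partialDeriv i) fun N => (h (N + 1)).2 i).norm_left.const_mul_left
        ‖ContinuousLinearMap.smulRightL ℝ (EuclideanSpace ℝ (Fin n)) ℝ (EuclideanSpace.proj i)‖
      rw [show δ - (j + 1 : ℕ) = δ - 1 - j by push_cast; ring]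
      refine (IsBigO.of_bound 1 ?_).trans (IsBigO.fun_sum fun i (_ : i ∈ Finset.univ) => h1 i)
      filter_upwards [eventually_cobounded_lt_norm R] with x hx
      rw [one_mul]
      exact (norm_iteratedFDeriv_succ_le_sum sf j hx).trans (le_abs_self _)
  · intro h N
    induction N generalizing f δ with
    | zero =>
      have := h 0
      rw [Nat.cast_zero, sub_zero] at this
      exact (IsBigO.of_norm_norm (by simpa using (isBigO_refl _ _))).trans this
    | succ N ih =>
      refine ⟨?_, fun i => ih (sf.partialDeriv i) fun j => ?_⟩
      · have := h 0
        rw [Nat.cast_zero, sub_zero] at this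
        exact (IsBigO.of_norm_norm (by simpa using (isBigO_refl _ _))).trans this
      · rw [show δ - 1 - j = δ - (j + 1 : ℕ) by push_cast; ring]
        refine (IsBigO.of_bound 1 ?_).trans (h (j + 1))
        filter_upwards [eventually_cobounded_lt_norm R] with x hx
        rw [one_mul]
        exact norm_iteratedFDeriv_partialDeriv_le sf i j hx

lemma bigOInfty_iff (sf : SmoothOutside R f) : BigOInfty f R δ ↔ ∀ N, DecayUpTo N f δ := by
  rw [isBigO_iteratedFDeriv_iff sf]
  refine forall_congr' fun j => ⟨?_, fun h => ?_⟩
  · rintro ⟨C, -, r, -, hb⟩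
    exact isBigO_of_bound C r hb
  · obtain ⟨C, hC, r, hr, hb⟩ := exists_bound_of_isBigO h R
    exact ⟨C, hC, r, hr.le, hb⟩

lemma IsHarmonicOn.harmonicOutside (hf : IsHarmonicOn f {x | R < ‖x‖}) : HarmonicOutside R f :=
  ⟨fun _ hx => hf.1.contDiffAt ((isOpen_exterior R).mem_nhds hx), hf.2⟩

lemma HarmonicOutside.bigOInfty_of_forall_isBigO (hf : HarmonicOutside R f)
    (hO : BigOInfty f R δ)
    (h : ∀ f : EuclideanSpace ℝ (Fin n) → ℝ, HarmonicOutside R f →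
      (∀ N, DecayUpTo N f δ) → f =O[cobounded _] fun x => ‖x‖ ^ p) : BigOInfty f R p :=
  (bigOInfty_iff hf.1).2 (decayUpTo_of_forall_isBigO h hf ((bigOInfty_iff hf.1).1 hO))

end ExceptionalRates

/-- Let `n ≥ 3`, `δ ∈ ℝ`, `R > 0`, and let `f` be harmonic on `{x ∈ ℝⁿ : |x| > R}` with
`f = 𝒪_∞(r^δ)`. Then `f = 𝒪_∞(r^{k₋(δ)})`, where `k₋(δ)` is the largest element of the
exceptional set `𝔈 = ℕ ∪ {k ∈ ℤ : k ≤ 2 − n}` that is `≤ δ`. -/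
theorem harmonic_decay_improves_to_exceptional_rate (n : ℕ) (hn : 3 ≤ n)
    (δ R : ℝ) (hR : 0 < R)
    (f : EuclideanSpace ℝ (Fin n) → ℝ)
    (hf : IsHarmonicOn f {x | R < ‖x‖})
    (hO : BigOInfty f R δ)
    (k : ℤ) (hk : 0 ≤ k ∨ k ≤ 2 - (n : ℤ)) (hkδ : (k : ℝ) ≤ δ)
    (hkmax : ∀ m : ℤ, (0 ≤ m ∨ m ≤ 2 - (n : ℤ)) → (m : ℝ) ≤ δ → m ≤ k) :
    BigOInfty f R (k : ℝ) := by
  refine hf.harmonicOutside.bigOInfty_of_forall_isBigO hO fun g hg hd => ?_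
  rcases le_or_gt 0 k with h0 | h0
  · lift k to ℕ using h0
    refine hg.isBigO_of_lt_high hn hR.le k hd ?_
    by_contra! hlt
    have := hkmax (k + 1) (Or.inl (by omega)) (by exact_mod_cast hlt)
    omega
  · have hk2 : k ≤ 2 - (n : ℤ) := hk.resolve_left (by omega)
    obtain ⟨m, hm⟩ := Int.eq_ofNat_of_zero_le (show 0 ≤ 2 - (n : ℤ) - k by omega)
    have hkm : (k : ℝ) = 2 - n - m := by
      rw [show k = 2 - (n : ℤ) - m by omega]
      push_cast
      ring
    rw [hkm]
    rcases Nat.eq_zero_or_pos m with rfl | hm0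
    · rw [Nat.cast_zero, sub_zero]
      refine hg.isBigO_of_tendsto_zero (by omega) hR.le (tendsto_zero_of_isBigO (hd 0).isBigO ?_)
      by_contra! hlt
      have := hkmax 0 (Or.inl le_rfl) (by exact_mod_cast hlt)
      omega
    · refine hg.isBigO_of_lt_low hn hR.le m hd ?_
      by_contra! hlt
      have := hkmax (k + 1) (Or.inr (by omega)) (by push_cast; linarith)
      omega
end
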